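/- arXiv:1311.7575 — 2 statements merged into one kernel-verified Lean document; each statement's English description precedes it below -/
import Mathlib

section
/- Let X and Y be pointed metric spaces, 1 ≤ s ≤ ∞, 0 < p ≤ s and p ≥ r > 0. If S : X → Y is a Lipschitz map such that for every Banach space F and every Lipschitz (p,m^L(s;p))-summing map T : Y → F the composition T ∘ S is Lipschitz (p,m^L(r;r))-summing, then S is Lipschitz (m^L(s;p),r)-summing and π^L_{(m^L(s;p),r)}(S) = sup { π^L_{(p,m^L(r;r))}(T ∘ S) : F a Banach space, T : Y → F Lipschitz (p,m^L(s;p))-summing with π^L_{(p,m^L(s;p))}(T) ≤ 1 }. -/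
open scoped ENNReal NNReal

noncomputable section

/-- The closed unit ball `B_{X^#}` of the Lipschitz dual of a pointed metric space `(X, x₀)`:
all Lipschitz functions `f : X → ℝ` with `f x₀ = 0` and Lipschitz constant at most `1`. -/
def dualBall (X : Type*) [MetricSpace X] (x₀ : X) : Set (X → ℝ) :=
  {f | LipschitzWith 1 f ∧ f x₀ = 0}

/-- The strong `ℓ_p` norm `‖(σ,x',x'')|ℓ_p‖ = (Σ_j |σ_j|^p d(x'_j,x''_j)^p)^{1/p}`
(with the sup for `p = ∞`). -/
def strongNorm {X : Type*} [MetricSpace X] (p : ℝ≥0∞) {m : ℕ}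
    (σ : Fin m → ℝ) (x' x'' : Fin m → X) : ℝ≥0∞ :=
  MeasureTheory.eLpNorm (fun j => σ j * dist (x' j) (x'' j)) p MeasureTheory.Measure.count

/-- The weak Lipschitz `ℓ_p` norm
`‖(σ,x',x'')|ℓ_p^{L,w}‖ = sup_{f ∈ B_{X^#}} (Σ_j |σ_j|^p |f(x'_j) - f(x''_j)|^p)^{1/p}`. -/
def weakNorm {X : Type*} [MetricSpace X] (x₀ : X) (p : ℝ≥0∞) {m : ℕ}
    (σ : Fin m → ℝ) (x' x'' : Fin m → X) : ℝ≥0∞ :=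
  ⨆ f ∈ dualBall X x₀, MeasureTheory.eLpNorm (fun j => σ j * (f (x' j) - f (x'' j))) p MeasureTheory.Measure.count

/-- The `q`-conjugate index `s'(q)`, determined by `1/s'(q) = 1/q - 1/s`. -/
def conjIdx (q s : ℝ≥0∞) : ℝ≥0∞ := (1 / q - 1 / s)⁻¹

/-- The Lipschitz mixed `(s;q)`-norm
`m^L_{(s;q)}(σ,x',x'') = inf ‖τ|ℓ_{s'(q)}‖ ⬝ ‖(σ/τ,x',x'')|ℓ_s^{L,w}‖`,
the infimum over all finite sequences `τ` of nonzero reals. -/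
def mixedNorm {X : Type*} [MetricSpace X] (x₀ : X) (s q : ℝ≥0∞) {m : ℕ}
    (σ : Fin m → ℝ) (x' x'' : Fin m → X) : ℝ≥0∞ :=
  ⨅ (τ : Fin m → ℝ) (_ : ∀ j, τ j ≠ 0),
    MeasureTheory.eLpNorm τ (conjIdx q s) MeasureTheory.Measure.count * weakNorm x₀ s (fun j => σ j / τ j) x' x''

/-- `T` is Lipschitz `(m^L(s;q),p)`-summing:
`m^L_{(s;q)}(σ,Tx',Tx'') ≤ C ⬝ ‖(σ,x',x'')|ℓ_p^{L,w}‖` for all finite sequences. -/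
def LipMixedP {X Y : Type*} [MetricSpace X] [MetricSpace Y] (x₀ : X) (y₀ : Y)
    (s q p : ℝ≥0∞) (T : X → Y) : Prop :=
  ∃ C : ℝ≥0, ∀ (m : ℕ) (σ : Fin m → ℝ) (x' x'' : Fin m → X),
    mixedNorm y₀ s q σ (T ∘ x') (T ∘ x'') ≤ C * weakNorm x₀ p σ x' x''

/-- The norm `π^L_{(m^L(s;q),p)}(T)`, the least constant in the defining inequality. -/
def lipMixedPNorm {X Y : Type*} [MetricSpace X] [MetricSpace Y] (x₀ : X) (y₀ : Y)
    (s q p : ℝ≥0∞) (T : X → Y) : ℝ≥0∞ :=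
  sInf {C : ℝ≥0∞ | ∀ (m : ℕ) (σ : Fin m → ℝ) (x' x'' : Fin m → X),
    mixedNorm y₀ s q σ (T ∘ x') (T ∘ x'') ≤ C * weakNorm x₀ p σ x' x''}

/-- `T` is Lipschitz `(p,m^L(s;q))`-summing:
`‖(σ,Tx',Tx'')|ℓ_p‖ ≤ C ⬝ m^L_{(s;q)}(σ,x',x'')` for all finite sequences. -/
def LipPMixed {X Y : Type*} [MetricSpace X] [MetricSpace Y] (x₀ : X)
    (p s q : ℝ≥0∞) (T : X → Y) : Prop :=
  ∃ C : ℝ≥0, ∀ (m : ℕ) (σ : Fin m → ℝ) (x' x'' : Fin m → X),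
    strongNorm p σ (T ∘ x') (T ∘ x'') ≤ C * mixedNorm x₀ s q σ x' x''

/-- The norm `π^L_{(p,m^L(s;q))}(T)`, the least constant in the defining inequality. -/
def lipPMixedNorm {X Y : Type*} [MetricSpace X] [MetricSpace Y] (x₀ : X)
    (p s q : ℝ≥0∞) (T : X → Y) : ℝ≥0∞ :=
  sInf {C : ℝ≥0∞ | ∀ (m : ℕ) (σ : Fin m → ℝ) (x' x'' : Fin m → X),
    strongNorm p σ (T ∘ x') (T ∘ x'') ≤ C * mixedNorm x₀ s q σ x' x''}

/-- The Lipschitz constant of a map, as an element of `ℝ≥0∞` (equal to `∞` if the map is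
not Lipschitz). -/
def lipConst {α β : Type*} [PseudoEMetricSpace α] [PseudoEMetricSpace β] (f : α → β) : ℝ≥0∞ :=
  ⨅ (K : ℝ≥0) (_ : LipschitzWith K f), (K : ℝ≥0∞)


/-- A (real) Banach space together with a map from `Y` into it. -/
structure BanachMap (Y : Type*) where
  F : Type
  [instGroup : NormedAddCommGroup F]
  [instSpace : NormedSpace ℝ F]
  [instComplete : CompleteSpace F]
  T : Y → F

attribute [instance] BanachMap.instGroup BanachMap.instSpace BanachMap.instComplete

open MeasureTheory in
lemma eLpNorm_fin {m : ℕ} (g : Fin m → ℝ) {p : ℝ≥0∞} (h0 : p ≠ 0) (ht : p ≠ ∞) :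
    eLpNorm g p Measure.count = (∑ j, ‖g j‖ₑ ^ p.toReal) ^ (1 / p.toReal) := by
  rw [eLpNorm_eq_lintegral_rpow_enorm_toReal h0 ht, lintegral_count, tsum_fintype]

open MeasureTheory in
lemma eLpNorm_fin_top {m : ℕ} (g : Fin m → ℝ) :
    eLpNorm g ∞ Measure.count = ⨆ j, ‖g j‖ₑ := by
  simp

lemma abs_sub_le_of_dualBall {Y : Type*} [MetricSpace Y] {y₀ : Y} {f : Y → ℝ}
    (hf : f ∈ dualBall Y y₀) (a b : Y) : ‖f a - f b‖ₑ ≤ edist a b := by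
  have := hf.1 a b
  rw [← edist_eq_enorm_sub]
  simpa using this

lemma weakNorm_le_strongNorm {Y : Type*} [MetricSpace Y] (y₀ : Y) (p : ℝ≥0∞) {m : ℕ}
    (σ : Fin m → ℝ) (y' y'' : Fin m → Y) : weakNorm y₀ p σ y' y'' ≤ strongNorm p σ y' y'' := by
  refine iSup₂_le fun f hf => ?_
  refine MeasureTheory.eLpNorm_mono_enorm fun j => ?_
  rw [enorm_mul, enorm_mul]
  gcongr
  refine (abs_sub_le_of_dualBall hf _ _).trans ?_
  rw [edist_dist, Real.enorm_eq_ofReal dist_nonneg]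

lemma strongNorm_lt_top {Y : Type*} [MetricSpace Y] (p : ℝ≥0∞) {m : ℕ}
    (σ : Fin m → ℝ) (y' y'' : Fin m → Y) : strongNorm p σ y' y'' < ∞ :=
  MeasureTheory.eLpNorm_count_lt_top_of_lt fun _ => enorm_lt_top

lemma mixedNorm_self_le {Y : Type*} [MetricSpace Y] (y₀ : Y) (p : ℝ≥0∞) {m : ℕ}
    (σ : Fin m → ℝ) (y' y'' : Fin m → Y) : mixedNorm y₀ p p σ y' y'' ≤ weakNorm y₀ p σ y' y'' := by
  refine (iInf₂_le (fun _ => (1 : ℝ)) (fun _ => one_ne_zero)).trans ?_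
  have : conjIdx p p = ∞ := by simp [conjIdx]
  rw [this, eLpNorm_fin_top]
  simp only [div_one]
  calc _ ≤ 1 * weakNorm y₀ p σ y' y'' := by
        gcongr
        exact iSup_le fun _ => by simp
    _ = _ := one_mul _

open MeasureTheory in
lemma holder_conj {p s : ℝ≥0∞} (hps : p ≤ s) {m : ℕ} (τ g : Fin m → ℝ) (hτ : ∀ j, τ j ≠ 0) :
    eLpNorm g p Measure.count ≤
      eLpNorm τ (conjIdx p s) Measure.count * eLpNorm (fun j => g j / τ j) s Measure.count := by
  have : ENNReal.HolderTriple (conjIdx p s) s p := ⟨by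
    rw [conjIdx, inv_inv, one_div, one_div]
    exact tsub_add_cancel_of_le (ENNReal.inv_le_inv.2 hps)⟩
  have := eLpNorm_smul_le_mul_eLpNorm (μ := Measure.count) (p := conjIdx p s) (q := s) (r := p)
    (f := fun j => g j / τ j) (φ := τ) .of_discrete .of_discrete
  convert this using 2
  ext j
  simp [mul_div_cancel₀, hτ j]

lemma le_mixedNorm_self {Y : Type*} [MetricSpace Y] (y₀ : Y) (p : ℝ≥0∞) {m : ℕ}
    (σ : Fin m → ℝ) (y' y'' : Fin m → Y) : weakNorm y₀ p σ y' y'' ≤ mixedNorm y₀ p p σ y' y'' := by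
  refine le_iInf₂ fun τ hτ => iSup₂_le fun f hf => ?_
  refine (holder_conj le_rfl τ _ hτ).trans ?_
  gcongr
  refine le_trans (le_of_eq ?_) (le_iSup₂ (α := ℝ≥0∞) f hf)
  congr 1
  ext j
  ring

lemma mixedNorm_self {Y : Type*} [MetricSpace Y] (y₀ : Y) (p : ℝ≥0∞) {m : ℕ}
    (σ : Fin m → ℝ) (y' y'' : Fin m → Y) : mixedNorm y₀ p p σ y' y'' = weakNorm y₀ p σ y' y'' :=
  le_antisymm (mixedNorm_self_le ..) (le_mixedNorm_self ..)

lemma le_sInf_mul {A a b : ℝ≥0∞} {P : Set ℝ≥0∞} (hb : b ≠ ∞) (hA : sInf P ≤ A)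
    (hP : ∀ C ∈ P, a ≤ C * b) (hA' : A ≠ ∞) : a ≤ A * b := by
  have h1 : ∀ ε : ℝ≥0, 0 < ε → a ≤ (A + ε) * b := by
    intro ε hε
    have : sInf P < A + ε := hA.trans_lt (ENNReal.lt_add_right hA' (by exact_mod_cast hε.ne'))
    obtain ⟨C, hC, hlt⟩ := sInf_lt_iff.1 this
    exact (hP C hC).trans (by gcongr)
  have h2 : Filter.Tendsto (fun ε : ℝ≥0 => (A + ε) * b) (nhdsWithin 0 (Set.Ioi 0)) (nhds ((A + (0:ℝ≥0)) * b)) := by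
    refine Filter.Tendsto.mono_left ?_ nhdsWithin_le_nhds
    refine ENNReal.Tendsto.mul_const ?_ (Or.inr hb)
    exact (tendsto_const_nhds.add (ENNReal.continuous_coe.tendsto 0))
  have := ge_of_tendsto h2 (Filter.eventually_of_mem self_mem_nhdsWithin fun ε hε => h1 ε hε)
  simpa using this

/-- data of a discrete measure on the dual ball -/
structure Dat (Y : Type*) [MetricSpace Y] (y₀ : Y) where
  ι : Type
  c : ι → ℝ≥0
  f : ι → Y → ℝ
  hf : ∀ i, f i ∈ dualBall Y y₀
  hc : ∑' i, (c i : ℝ≥0∞) ≤ 1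

namespace Dat
variable {Y : Type*} [MetricSpace Y] {y₀ : Y}

def val (D : Dat Y y₀) (s : ℝ≥0∞) (y : Y) : D.ι → ℝ :=
  fun i => (D.c i : ℝ) ^ (1 / s.toReal) * D.f i y

lemma norm_f_le (D : Dat Y y₀) (i : D.ι) (y : Y) : ‖D.f i y‖ ≤ dist y y₀ := by
  have := (D.hf i).1.dist_le_mul y y₀
  rw [(D.hf i).2] at this
  simpa using this

lemma summable_c (D : Dat Y y₀) : Summable (fun i => (D.c i : ℝ)) := by
  rw [NNReal.summable_coe]
  exact ENNReal.tsum_coe_ne_top_iff_summable.1 (ne_top_of_le_ne_top ENNReal.one_ne_top D.hc)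

lemma norm_rpow (D : Dat Y y₀) {s : ℝ≥0∞} (hs : 1 ≤ s) (hst : s ≠ ∞) (i : D.ι) (x : ℝ) :
    ‖(D.c i : ℝ) ^ (1 / s.toReal) * x‖ ^ s.toReal = D.c i * ‖x‖ ^ s.toReal := by
  have h0 : s.toReal ≠ 0 := (ENNReal.toReal_pos (by positivity) hst).ne'
  rw [norm_mul, Real.mul_rpow (norm_nonneg _) (norm_nonneg _),
    Real.norm_of_nonneg (by positivity), ← Real.rpow_mul (by positivity),
    one_div_mul_cancel h0, Real.rpow_one]

lemma mem (D : Dat Y y₀) {s : ℝ≥0∞} (hs : 1 ≤ s) (y : Y) : Memℓp (D.val s y) s := by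
  by_cases hst : s = ∞
  · subst hst
    refine memℓp_infty ⟨dist y y₀, ?_⟩
    rintro _ ⟨i, rfl⟩
    simpa [val] using D.norm_f_le i y
  · refine memℓp_gen ?_
    refine Summable.of_nonneg_of_le (fun i => by positivity) (fun i => ?_)
      (D.summable_c.mul_right (dist y y₀ ^ s.toReal))
    rw [val, D.norm_rpow hs hst]
    gcongr
    exact D.norm_f_le i y

def T (D : Dat Y y₀) {s : ℝ≥0∞} (hs : 1 ≤ s) (y : Y) : lp (fun _ : D.ι => ℝ) s :=
  ⟨D.val s y, D.mem hs y⟩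

def w (D : Dat Y y₀) {s : ℝ≥0∞} (hs : 1 ≤ s) : BanachMap Y :=
  haveI : Fact (1 ≤ s) := ⟨hs⟩
  { F := lp (fun _ : D.ι => ℝ) s
    T := D.T hs }

/-- the distance in the target -/
def δ (D : Dat Y y₀) {s : ℝ≥0∞} (hs : 1 ≤ s) (a b : Y) : ℝ := dist ((D.w hs).T a) ((D.w hs).T b)

lemma strong_eq (D : Dat Y y₀) {s : ℝ≥0∞} (hs : 1 ≤ s) (p : ℝ≥0∞) {m : ℕ} (σ : Fin m → ℝ)
    (y' y'' : Fin m → Y) : strongNorm p σ ((D.w hs).T ∘ y') ((D.w hs).T ∘ y'') =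
    MeasureTheory.eLpNorm (fun j => σ j * D.δ hs (y' j) (y'' j)) p MeasureTheory.Measure.count := rfl

lemma δ_nonneg (D : Dat Y y₀) {s : ℝ≥0∞} (hs : 1 ≤ s) (a b : Y) : 0 ≤ D.δ hs a b := dist_nonneg

lemma δ_rpow (D : Dat Y y₀) {s : ℝ≥0∞} (hs : 1 ≤ s) (hst : s ≠ ∞) (a b : Y) :
    HasSum (fun i => (D.c i : ℝ) * ‖D.f i a - D.f i b‖ ^ s.toReal) (D.δ hs a b ^ s.toReal) := by
  haveI : Fact (1 ≤ s) := ⟨hs⟩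
  have h0 : 0 < s.toReal := ENNReal.toReal_pos (by positivity) hst
  have := lp.hasSum_norm h0 (D.T hs a - D.T hs b)
  have e : D.δ hs a b = ‖D.T hs a - D.T hs b‖ := dist_eq_norm (D.T hs a) (D.T hs b)
  rw [e]
  convert this using 2 with i
  rw [← D.norm_rpow hs hst, mul_sub]
  rfl

lemma δ_rpow_enorm (D : Dat Y y₀) {s : ℝ≥0∞} (hs : 1 ≤ s) (hst : s ≠ ∞) (a b : Y) :
    ‖D.δ hs a b‖ₑ ^ s.toReal = ∑' i, (D.c i : ℝ≥0∞) * ‖D.f i a - D.f i b‖ₑ ^ s.toReal := by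
  have h := D.δ_rpow hs hst a b
  have h2 := ENNReal.ofReal_tsum_of_nonneg (fun i => by positivity) h.summable
  rw [h.tsum_eq] at h2
  rw [Real.enorm_eq_ofReal (D.δ_nonneg hs a b), ENNReal.ofReal_rpow_of_nonneg (D.δ_nonneg hs a b) (by positivity), h2]
  congr 1
  ext i
  rw [ENNReal.ofReal_mul (by positivity), ENNReal.ofReal_coe_nnreal, ← ENNReal.ofReal_rpow_of_nonneg (by positivity) (by positivity), ofReal_norm]

lemma δ_top_le (D : Dat Y y₀) (hs : 1 ≤ (∞ : ℝ≥0∞)) (a b : Y) {C : ℝ} (hC : 0 ≤ C)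
    (h : ∀ i, ‖D.f i a - D.f i b‖ ≤ C) : D.δ hs a b ≤ C := by
  have e : D.δ hs a b = ‖D.T hs a - D.T hs b‖ := dist_eq_norm (D.T hs a) (D.T hs b)
  rw [e]
  refine lp.norm_le_of_forall_le hC fun i => ?_
  have : (D.T hs a - D.T hs b) i = D.f i a - D.f i b := by
    change D.val ∞ a i - D.val ∞ b i = _
    simp [val]
  rw [this]
  exact h i

lemma le_δ_top (D : Dat Y y₀) (hs : 1 ≤ (∞ : ℝ≥0∞)) (a b : Y) (i : D.ι) :
    ‖D.f i a - D.f i b‖ ≤ D.δ hs a b := by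
  have e : D.δ hs a b = ‖D.T hs a - D.T hs b‖ := dist_eq_norm (D.T hs a) (D.T hs b)
  rw [e]
  have : (D.T hs a - D.T hs b) i = D.f i a - D.f i b := by
    change D.val ∞ a i - D.val ∞ b i = _
    simp [val]
  rw [← this]
  exact lp.norm_apply_le_norm (by simp) _ i

open MeasureTheory in
lemma eLpNorm_δ_le (D : Dat Y y₀) {s : ℝ≥0∞} (hs : 1 ≤ s) {m : ℕ} (g : Fin m → ℝ)
    (y' y'' : Fin m → Y) :
    eLpNorm (fun j => g j * D.δ hs (y' j) (y'' j)) s Measure.count ≤ weakNorm y₀ s g y' y'' := by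
  have hW : ∀ i, eLpNorm (fun j => g j * (D.f i (y' j) - D.f i (y'' j))) s Measure.count
      ≤ weakNorm y₀ s g y' y'' := fun i => le_iSup₂ (α := ℝ≥0∞) (D.f i) (D.hf i)
  generalize weakNorm y₀ s g y' y'' = W at hW
  by_cases hst : s = ∞
  · subst hst
    simp only [eLpNorm_fin_top] at hW ⊢
    refine iSup_le fun j => ?_
    rcases eq_or_ne W ∞ with rfl | hWt
    · exact le_top
    lift W to ℝ≥0 using hWt
    have h2 : ∀ i, ‖g j‖ * ‖D.f i (y' j) - D.f i (y'' j)‖ ≤ W := fun i => by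
      have h3 := (le_iSup (fun j => ‖g j * (D.f i (y' j) - D.f i (y'' j))‖ₑ) j).trans (hW i)
      rw [← norm_mul]
      rw [enorm_le_coe] at h3
      exact_mod_cast h3
    rw [enorm_le_coe, ← NNReal.coe_le_coe, coe_nnnorm, norm_mul, Real.norm_of_nonneg (D.δ_nonneg hs _ _)]
    rcases eq_or_ne (g j) 0 with h0 | h0
    · simp [h0]
    have h0' : 0 < ‖g j‖ := norm_pos_iff.2 h0
    rw [mul_comm, ← le_div_iff₀ h0']
    refine D.δ_top_le hs _ _ (by positivity) fun i => ?_
    rw [le_div_iff₀ h0', mul_comm]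
    exact h2 i
  · have h0 : 0 < s.toReal := ENNReal.toReal_pos (by positivity) hst
    have hs0 : s ≠ 0 := by positivity
    rw [eLpNorm_fin _ hs0 hst, one_div, ENNReal.rpow_inv_le_iff h0]
    simp only [eLpNorm_fin _ hs0 hst, one_div, ENNReal.rpow_inv_le_iff h0] at hW
    simp only [enorm_mul, ENNReal.mul_rpow_of_nonneg _ _ h0.le] at hW ⊢
    calc ∑ j, ‖g j‖ₑ ^ s.toReal * ‖D.δ hs (y' j) (y'' j)‖ₑ ^ s.toReal
        = ∑ j, ∑' i, (D.c i : ℝ≥0∞) * (‖g j‖ₑ ^ s.toReal * ‖D.f i (y' j) - D.f i (y'' j)‖ₑ ^ s.toReal) := by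
          refine Finset.sum_congr rfl fun j _ => ?_
          rw [D.δ_rpow_enorm hs hst, ← ENNReal.tsum_mul_left]
          congr 1; ext i; ring
      _ = ∑' i, (D.c i : ℝ≥0∞) * ∑ j, (‖g j‖ₑ ^ s.toReal * ‖D.f i (y' j) - D.f i (y'' j)‖ₑ ^ s.toReal) := by
          rw [← Summable.tsum_finsetSum (fun _ _ => ENNReal.summable)]
          simp only [Finset.mul_sum]
      _ ≤ ∑' i, (D.c i : ℝ≥0∞) * W ^ s.toReal := by
          gcongr with i
          exact hW i
      _ = (∑' i, (D.c i : ℝ≥0∞)) * W ^ s.toReal := ENNReal.tsum_mul_right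
      _ ≤ 1 * W ^ s.toReal := by gcongr; exact D.hc
      _ = _ := one_mul _

lemma strong_le (D : Dat Y y₀) {s p : ℝ≥0∞} (hs : 1 ≤ s) (hps : p ≤ s) {m : ℕ} (σ : Fin m → ℝ)
    (y' y'' : Fin m → Y) :
    strongNorm p σ ((D.w hs).T ∘ y') ((D.w hs).T ∘ y'') ≤ mixedNorm y₀ s p σ y' y'' := by
  rw [strong_eq]
  refine le_iInf₂ fun τ hτ => ?_
  refine (holder_conj hps τ _ hτ).trans ?_
  gcongr
  refine le_trans (le_of_eq ?_) (D.eLpNorm_δ_le hs (fun j => σ j / τ j) y' y'')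
  congr 1
  ext j
  ring

lemma lip (D : Dat Y y₀) {s : ℝ≥0∞} (hs : 1 ≤ s) : LipschitzWith 1 (D.w hs).T := by
  intro a b
  have h := (D.eLpNorm_δ_le hs (m := 1) (fun _ => 1) (fun _ => a) (fun _ => b)).trans
    (weakNorm_le_strongNorm y₀ s _ _ _)
  have hs0 : s ≠ 0 := by positivity
  have key : ∀ x : ℝ, MeasureTheory.eLpNorm (fun _ : Fin 1 => x) s MeasureTheory.Measure.count = ‖x‖ₑ := by
    intro x
    by_cases hst : s = ∞
    · subst hst; rw [eLpNorm_fin_top]; simp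
    · have h0 : s.toReal ≠ 0 := (ENNReal.toReal_pos (by positivity) hst).ne'
      rw [eLpNorm_fin _ hs0 hst]
      simp [ENNReal.rpow_rpow_inv, h0]
  rw [strongNorm, key, key, one_mul, one_mul, Real.enorm_eq_ofReal (D.δ_nonneg hs _ _),
    Real.enorm_eq_ofReal dist_nonneg] at h
  rw [ENNReal.coe_one, one_mul, edist_dist, edist_dist]
  exact h

lemma lipPMixed (D : Dat Y y₀) {s p : ℝ≥0∞} (hs : 1 ≤ s) (hps : p ≤ s) :
    LipPMixed y₀ p s p (D.w hs).T :=
  ⟨1, fun m σ y' y'' => by simpa using D.strong_le hs hps σ y' y''⟩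

lemma lipPMixedNorm_le (D : Dat Y y₀) {s p : ℝ≥0∞} (hs : 1 ≤ s) (hps : p ≤ s) :
    lipPMixedNorm y₀ p s p (D.w hs).T ≤ 1 :=
  sInf_le fun m σ y' y'' => by simpa using D.strong_le hs hps σ y' y''

end Dat

open MeasureTheory in
lemma eLpNorm_fin_real {m : ℕ} (g : Fin m → ℝ) {p : ℝ≥0∞} (h0 : p ≠ 0) (ht : p ≠ ∞) :
    eLpNorm g p Measure.count = (ENNReal.ofReal (∑ j, ‖g j‖ ^ p.toReal)) ^ (1 / p.toReal) := by
  rw [eLpNorm_fin g h0 ht, ENNReal.ofReal_sum_of_nonneg (fun _ _ => by positivity)]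
  congr 2
  ext j
  rw [← ENNReal.ofReal_rpow_of_nonneg (by positivity) (by positivity), ofReal_norm]

namespace Dat
variable {Y : Type*} [MetricSpace Y] {y₀ : Y}

def glue (D : ℕ → Dat Y y₀) : Dat Y y₀ where
  ι := Σ k, (D k).ι
  c := fun i => (2⁻¹ : ℝ≥0) ^ (i.1 + 1) * (D i.1).c i.2
  f := fun i => (D i.1).f i.2
  hf := fun i => (D i.1).hf i.2
  hc := by
    rw [ENNReal.tsum_sigma']
    simp only [ENNReal.coe_mul, ENNReal.tsum_mul_left]
    calc _ ≤ ∑' k : ℕ, ((2⁻¹ : ℝ≥0∞) ^ (k + 1)) * 1 := by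
          refine ENNReal.tsum_le_tsum fun k => ?_
          refine mul_le_mul' (le_of_eq ?_) (D k).hc
          rw [ENNReal.coe_pow, ENNReal.coe_inv two_ne_zero]; rfl
      _ ≤ 1 := by
          simp only [mul_one, ENNReal.tsum_geometric_add_one, ENNReal.one_sub_inv_two, inv_inv]
          rw [ENNReal.inv_mul_cancel two_ne_zero ENNReal.ofNat_ne_top]

lemma glue_le (D : ℕ → Dat Y y₀) {s : ℝ≥0∞} (hs : 1 ≤ s) (k : ℕ) (a b : Y) :
    ‖(D k).δ hs a b‖ₑ ≤ 2 ^ (k + 1) * ‖(glue D).δ hs a b‖ₑ := by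
  by_cases hst : s = ∞
  · subst hst
    have h1 : (D k).δ hs a b ≤ (glue D).δ hs a b :=
      (D k).δ_top_le hs a b ((glue D).δ_nonneg hs a b) fun i => (glue D).le_δ_top hs a b ⟨k, i⟩
    rw [Real.enorm_eq_ofReal ((D k).δ_nonneg hs _ _), Real.enorm_eq_ofReal ((glue D).δ_nonneg hs _ _)]
    calc _ ≤ 1 * ENNReal.ofReal ((glue D).δ hs a b) := by
          rw [one_mul]; exact ENNReal.ofReal_le_ofReal h1
      _ ≤ _ := by
          gcongr
          exact one_le_pow₀ (by norm_num)
  · have h0 : 0 < s.toReal := ENNReal.toReal_pos (by positivity) hst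
    have h1 : 1 ≤ s.toReal := by
      have := ENNReal.toReal_mono hst hs
      simpa using this
    have key : (2⁻¹ : ℝ≥0∞) ^ (k + 1) * ‖(D k).δ hs a b‖ₑ ^ s.toReal ≤ ‖(glue D).δ hs a b‖ₑ ^ s.toReal := by
      rw [(D k).δ_rpow_enorm hs hst, (glue D).δ_rpow_enorm hs hst, ← ENNReal.tsum_mul_left]
      refine le_trans (le_of_eq ?_) (ENNReal.tsum_comp_le_tsum_of_injective (f := fun i : (D k).ι => (⟨k, i⟩ : (glue D).ι)) ?_ _)
      · congr 1
        ext i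
        change _ = (((2⁻¹ : ℝ≥0) ^ (k + 1) * (D k).c i : ℝ≥0) : ℝ≥0∞) * ‖(D k).f i a - (D k).f i b‖ₑ ^ s.toReal
        rw [ENNReal.coe_mul, ENNReal.coe_pow, ENNReal.coe_inv two_ne_zero, mul_assoc]; rfl
      · intro i j hij
        simpa using hij
    rw [← ENNReal.rpow_le_rpow_iff h0, ENNReal.mul_rpow_of_nonneg _ _ h0.le]
    calc ‖(D k).δ hs a b‖ₑ ^ s.toReal
        = 2 ^ (k + 1) * ((2⁻¹ : ℝ≥0∞) ^ (k + 1) * ‖(D k).δ hs a b‖ₑ ^ s.toReal) := by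
          rw [← mul_assoc, ← mul_pow, ENNReal.mul_inv_cancel two_ne_zero ENNReal.ofNat_ne_top, one_pow, one_mul]
      _ ≤ _ := by
          gcongr
          calc (2 : ℝ≥0∞) ^ (k + 1) = (2 ^ (k + 1)) ^ (1 : ℝ) := (ENNReal.rpow_one _).symm
            _ ≤ _ := ENNReal.rpow_le_rpow_of_exponent_le (one_le_pow₀ (by norm_num)) h1

open MeasureTheory in
lemma strong_glue_le (D : ℕ → Dat Y y₀) {s p : ℝ≥0∞} (hs : 1 ≤ s) (k : ℕ) {m : ℕ} (σ : Fin m → ℝ)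
    (y' y'' : Fin m → Y) :
    strongNorm p σ (((D k).w hs).T ∘ y') (((D k).w hs).T ∘ y'') ≤
      2 ^ (k + 1) * strongNorm p σ (((glue D).w hs).T ∘ y') (((glue D).w hs).T ∘ y'') := by
  rw [strong_eq, strong_eq]
  have : (2 : ℝ≥0∞) ^ (k + 1) = ‖(2 : ℝ) ^ (k + 1)‖ₑ := by
    rw [enorm_pow]; congr 1; rw [Real.enorm_eq_ofReal (by norm_num)]; simp
  rw [this, ← eLpNorm_const_smul]
  refine eLpNorm_mono_enorm fun j => ?_
  simp only [Pi.smul_apply, smul_eq_mul, enorm_mul, ← this]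
  calc _ ≤ ‖σ j‖ₑ * (2 ^ (k + 1) * ‖(glue D).δ hs (y' j) (y'' j)‖ₑ) := by
        gcongr; exact glue_le D hs k _ _
    _ = _ := by ring

/-- single functional -/
def single {f : Y → ℝ} (hf : f ∈ dualBall Y y₀) : Dat Y y₀ where
  ι := Unit
  c := fun _ => 1
  f := fun _ => f
  hf := fun _ => hf
  hc := by simp

lemma single_le {f : Y → ℝ} (hf : f ∈ dualBall Y y₀) {s : ℝ≥0∞} (hs : 1 ≤ s) (a b : Y) :
    ‖f a - f b‖ₑ ≤ ‖(single hf).δ hs a b‖ₑ := by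
  by_cases hst : s = ∞
  · subst hst
    have := (single hf).le_δ_top hs a b ()
    rw [Real.enorm_eq_ofReal ((single hf).δ_nonneg hs _ _), ← ofReal_norm]
    exact ENNReal.ofReal_le_ofReal this
  · have h0 : 0 < s.toReal := ENNReal.toReal_pos (by positivity) hst
    rw [← ENNReal.rpow_le_rpow_iff h0, (single hf).δ_rpow_enorm hs hst]
    refine le_trans (le_of_eq ?_) (ENNReal.le_tsum ())
    simp [single]

lemma mixed_le_self {s : ℝ≥0∞} (hs : 1 ≤ s) {m : ℕ} (σ : Fin m → ℝ) (y' y'' : Fin m → Y) {B : ℝ≥0∞}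
    (h : ∀ D : Dat Y y₀, strongNorm s σ ((D.w hs).T ∘ y') ((D.w hs).T ∘ y'') ≤ B) :
    mixedNorm y₀ s s σ y' y'' ≤ B := by
  rw [mixedNorm_self]
  refine iSup₂_le fun f hf => le_trans ?_ (h (single hf))
  rw [strong_eq]
  refine MeasureTheory.eLpNorm_mono_enorm fun j => ?_
  rw [enorm_mul, enorm_mul]
  gcongr
  exact single_le hf hs _ _

/-- distance functionals -/
def dists {m : ℕ} (y : Fin m → Y) : Dat Y y₀ where
  ι := Fin m
  c := fun _ => 0
  f := fun i z => dist z (y i) - dist y₀ (y i)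
  hf := fun i => ⟨LipschitzWith.of_dist_le_mul fun a b => by
      simpa [Real.dist_eq] using abs_dist_sub_le a b (y i), by simp⟩
  hc := by simp

open MeasureTheory in
lemma mixed_le_top (hs : 1 ≤ (∞ : ℝ≥0∞)) {p : ℝ≥0∞} (hp : p ≠ 0) (hpt : p ≠ ∞) {m : ℕ}
    (σ : Fin m → ℝ) (y' y'' : Fin m → Y) {B : ℝ≥0∞}
    (h : ∀ D : Dat Y y₀, strongNorm p σ ((D.w hs).T ∘ y') ((D.w hs).T ∘ y'') ≤ B) :
    mixedNorm y₀ ∞ p σ y' y'' ≤ B := by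
  have hP : 0 < p.toReal := ENNReal.toReal_pos hp hpt
  have h1 : strongNorm p σ y' y'' ≤ B := by
    refine le_trans ?_ (h (dists y''))
    rw [strong_eq]
    refine MeasureTheory.eLpNorm_mono fun j => ?_
    rw [norm_mul, norm_mul]
    gcongr
    have := (dists (y₀ := y₀) y'').le_δ_top hs (y' j) (y'' j) j
    rw [Real.norm_of_nonneg (δ_nonneg _ _ _ _)]
    simpa [dists] using this
  refine le_trans ?_ h1
  have h2 : ∀ ε : ℝ, 0 < ε → mixedNorm y₀ ∞ p σ y' y'' ≤
      (ENNReal.ofReal (∑ j, (‖σ j * dist (y' j) (y'' j)‖ + ε) ^ p.toReal)) ^ (1 / p.toReal) := by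
    intro ε hε
    have hpos : ∀ j, 0 < ‖σ j * dist (y' j) (y'' j)‖ + ε := fun j => by positivity
    refine (iInf₂_le (fun j => ‖σ j * dist (y' j) (y'' j)‖ + ε) (fun j => (hpos j).ne')).trans ?_
    have hc : conjIdx p ∞ = p := by simp [conjIdx]
    rw [hc, eLpNorm_fin_real _ hp hpt]
    simp only [Real.norm_of_nonneg (hpos _).le]
    refine mul_le_of_le_one_right' ?_
    refine iSup₂_le fun f hf => ?_
    rw [eLpNorm_fin_top]
    refine iSup_le fun j => ?_
    rw [← ofReal_norm, ENNReal.ofReal_le_one, div_mul_eq_mul_div, norm_div,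
      Real.norm_of_nonneg (hpos j).le, div_le_one (hpos j), norm_mul, norm_mul]
    have : ‖f (y' j) - f (y'' j)‖ ≤ ‖dist (y' j) (y'' j)‖ := by
      simpa [Real.dist_eq] using hf.1.dist_le_mul (y' j) (y'' j)
    have h3 : ‖σ j‖ * ‖f (y' j) - f (y'' j)‖ ≤ ‖σ j‖ * ‖dist (y' j) (y'' j)‖ := by gcongr
    linarith
  have h3 : Continuous (fun ε : ℝ => (ENNReal.ofReal (∑ j, (‖σ j * dist (y' j) (y'' j)‖ + ε) ^ p.toReal)) ^ (1 / p.toReal)) := by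
    refine ENNReal.continuous_rpow_const.comp (ENNReal.continuous_ofReal.comp ?_)
    refine continuous_finsetSum _ fun j _ => ?_
    exact (continuous_const.add continuous_id).rpow_const fun _ => Or.inr hP.le
  have h4 := ge_of_tendsto ((h3.tendsto 0).mono_left (nhdsWithin_le_nhds (s := Set.Ioi 0)))
    (Filter.eventually_of_mem self_mem_nhdsWithin fun ε hε => h2 ε hε)
  rw [strongNorm, eLpNorm_fin_real _ hp hpt]
  simpa using h4

end Dat

lemma grad_ineq {m : ℕ} {α ε : ℝ} (hα : 0 < α) (hε : 0 < ε) {K : Set (Fin m → ℝ)}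
    (hK : Convex ℝ K) (hK0 : ∀ v ∈ K, ∀ j, 0 ≤ v j) {u v : Fin m → ℝ} (hu : u ∈ K) (hv : v ∈ K)
    (hmax : ∀ z ∈ K, ∑ j, (z j + ε) ^ α ≤ ∑ j, (u j + ε) ^ α) :
    ∑ j, v j * (u j + ε) ^ (α - 1) ≤ ∑ j, (u j + ε) ^ α := by
  have hpos : ∀ j, 0 < u j + ε := fun j => by have := hK0 u hu j; linarith
  have hd : HasDerivAt (fun t : ℝ => ∑ j, (u j + ε + t * (v j - u j)) ^ α)
      (∑ j, (v j - u j) * α * (u j + ε) ^ (α - 1)) 0 := by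
    refine HasDerivAt.fun_sum fun j _ => ?_
    have h1 : HasDerivAt (fun t : ℝ => u j + ε + t * (v j - u j)) (v j - u j) 0 := by
      simpa using ((hasDerivAt_id (0 : ℝ)).mul_const (v j - u j)).const_add (u j + ε)
    have := h1.rpow_const (p := α) (Or.inl (by simpa using (hpos j).ne'))
    simpa using this
  have hle : ∑ j, (v j - u j) * α * (u j + ε) ^ (α - 1) ≤ 0 := by
    rw [hasDerivAt_iff_tendsto_slope] at hd
    have hd' := hd.mono_left (nhdsWithin_mono (0 : ℝ) (s := Set.Ioi 0) (fun x hx => ne_of_gt hx))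
    refine le_of_tendsto hd' ?_
    filter_upwards [Ioo_mem_nhdsGT (zero_lt_one (α := ℝ))] with t ht
    have hz := hK hu hv (a := 1 - t) (b := t) (by linarith [ht.2]) ht.1.le (by ring)
    have := hmax _ hz
    rw [slope_def_field]
    refine div_nonpos_of_nonpos_of_nonneg ?_ (by linarith [ht.1])
    simp only [zero_mul, add_zero, sub_nonpos]
    refine le_trans (le_of_eq ?_) this
    refine Finset.sum_congr rfl fun j _ => ?_
    congr 1
    simp only [Pi.add_apply, Pi.smul_apply, smul_eq_mul]
    ring
  have h2 : ∑ j, (v j - u j) * α * (u j + ε) ^ (α - 1) =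
      α * (∑ j, (v j + ε) * (u j + ε) ^ (α - 1) - ∑ j, (u j + ε) ^ α) := by
    rw [← Finset.sum_sub_distrib, Finset.mul_sum]
    refine Finset.sum_congr rfl fun j _ => ?_
    have : (u j + ε) ^ α = (u j + ε) * (u j + ε) ^ (α - 1) := by
      rw [Real.rpow_sub_one (hpos j).ne']
      field_simp [(hpos j).ne']
    rw [this]; ring
  rw [h2] at hle
  have h3 : ∑ j, (v j + ε) * (u j + ε) ^ (α - 1) - ∑ j, (u j + ε) ^ α ≤ 0 :=
    nonpos_of_mul_nonpos_right hle hα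
  refine le_trans (Finset.sum_le_sum fun j _ => ?_) (sub_nonpos.1 h3)
  have : 0 ≤ (u j + ε) ^ (α - 1) := Real.rpow_nonneg (hpos j).le _
  gcongr
  linarith

namespace Dat
variable {Y : Type*} [MetricSpace Y] {y₀ : Y}

lemma hull_bound {s p : ℝ≥0∞} (hs : 1 ≤ s) (hp : p ≠ 0) (hlt : p < s) (hst : s ≠ ∞) {m : ℕ}
    (σ : Fin m → ℝ) (y' y'' : Fin m → Y) {B : ℝ≥0∞} (hB : B ≠ ∞)
    (h : ∀ D : Dat Y y₀, strongNorm p σ ((D.w hs).T ∘ y') ((D.w hs).T ∘ y'') ≤ B)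
    (v : Fin m → ℝ) (hv : v ∈ convexHull ℝ
      ((fun (f : Y → ℝ) j => ‖σ j * (f (y' j) - f (y'' j))‖ ^ s.toReal) '' dualBall Y y₀)) :
    ∑ j, v j ^ (p.toReal / s.toReal) ≤ B.toReal ^ p.toReal := by
  have hpt : p ≠ ∞ := hlt.ne_top
  have hP : 0 < p.toReal := ENNReal.toReal_pos hp hpt
  have hQ : 0 < s.toReal := ENNReal.toReal_pos (by positivity) hst
  rw [mem_convexHull_iff_exists_fintype] at hv
  obtain ⟨ι, _, w, z, hw0, hw1, hz, hsum⟩ := hv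
  choose f hf hfz using hz
  lift w to ι → ℝ≥0 using hw0
  let D : Dat Y y₀ :=
    { ι := ι
      c := w
      f := f
      hf := hf
      hc := by
        rw [tsum_fintype, ← ENNReal.ofNNReal_finsetSum, ← ENNReal.coe_one, ENNReal.coe_le_coe,
          ← NNReal.coe_le_coe, NNReal.coe_sum]
        exact hw1.le }
  have hD := h D
  have hδ : ∀ j, ‖σ j * D.δ hs (y' j) (y'' j)‖ ^ s.toReal = v j := by
    intro j
    have h1 := D.δ_rpow hs hst (y' j) (y'' j)
    have h2 := h1.unique (hasSum_fintype (β := ι) _)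
    rw [norm_mul, Real.mul_rpow (norm_nonneg _) (norm_nonneg _),
      Real.norm_of_nonneg (D.δ_nonneg hs _ _), h2, Finset.mul_sum, ← hsum, Finset.sum_apply]
    refine Finset.sum_congr rfl fun i _ => ?_
    rw [Pi.smul_apply, ← hfz i, smul_eq_mul]
    change ‖σ j‖ ^ s.toReal * ((w i : ℝ) * ‖f i (y' j) - f i (y'' j)‖ ^ s.toReal) =
      (w i : ℝ) * ‖σ j * (f i (y' j) - f i (y'' j))‖ ^ s.toReal
    rw [norm_mul, Real.mul_rpow (norm_nonneg _) (norm_nonneg _)]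
    ring
  rw [strong_eq, eLpNorm_fin_real _ hp hpt, one_div, ENNReal.rpow_inv_le_iff hP,
    ← ENNReal.ofReal_toReal hB, ENNReal.ofReal_rpow_of_nonneg ENNReal.toReal_nonneg hP.le,
    ENNReal.ofReal_le_ofReal_iff (by positivity)] at hD
  refine le_trans (le_of_eq ?_) hD
  refine Finset.sum_congr rfl fun j _ => ?_
  rw [← hδ j, ← Real.rpow_mul (norm_nonneg _), mul_div_cancel₀ _ hQ.ne']

lemma mixed_le_main {s p : ℝ≥0∞} (hs : 1 ≤ s) (hp : p ≠ 0) (hlt : p < s) (hst : s ≠ ∞) {m : ℕ}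
    (σ : Fin m → ℝ) (y' y'' : Fin m → Y) {B : ℝ≥0∞} (hB : B ≠ ∞)
    (h : ∀ D : Dat Y y₀, strongNorm p σ ((D.w hs).T ∘ y') ((D.w hs).T ∘ y'') ≤ B) :
    mixedNorm y₀ s p σ y' y'' ≤ B := by
  have hb := hull_bound hs hp hlt hst σ y' y'' hB h
  have hpt : p ≠ ∞ := hlt.ne_top
  have hs0 : s ≠ 0 := by positivity
  have hP : 0 < p.toReal := ENNReal.toReal_pos hp hpt
  have hQ : 0 < s.toReal := ENNReal.toReal_pos (by positivity) hst
  have hPQ : p.toReal < s.toReal := (ENNReal.toReal_lt_toReal hpt hst).2 hlt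
  have hcr : (conjIdx p s).toReal = (1 / p.toReal - 1 / s.toReal)⁻¹ := by
    rw [conjIdx, ENNReal.toReal_inv, ENNReal.toReal_sub_of_le]
    · simp
    · rw [one_div, one_div]; exact ENNReal.inv_le_inv.2 hlt.le
    · simp [hp]
  have hcpos : 0 < 1 / p.toReal - 1 / s.toReal :=
    sub_pos.2 (one_div_lt_one_div_of_lt hP hPQ)
  have hc0 : 0 < (conjIdx p s).toReal := by rw [hcr]; positivity
  obtain ⟨hcne0, hcnet⟩ := ENNReal.toReal_pos_iff.1 hc0
  have hexp : 1 / (conjIdx p s).toReal + 1 / s.toReal = 1 / p.toReal := by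
    rw [hcr, one_div, inv_inv]; ring
  have hexp2 : (1 - p.toReal / s.toReal) / s.toReal * (conjIdx p s).toReal = p.toReal / s.toReal := by
    rw [hcr]
    have : s.toReal - p.toReal ≠ 0 := by linarith
    field_simp
  generalize hPd : p.toReal = P at *
  generalize hQd : s.toReal = Q at *
  generalize hRd : (conjIdx p s).toReal = R at *
  generalize hbd : B.toReal ^ P = b at *
  set V : Set (Fin m → ℝ) :=
    (fun (f : Y → ℝ) j => ‖σ j * (f (y' j) - f (y'' j))‖ ^ Q) '' dualBall Y y₀ with hV
  set α := P / Q with hαd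
  have hα : 0 < α := by positivity
  have hα1 : α ≤ 1 := (div_le_one hQ).2 hPQ.le
  set K := closure (convexHull ℝ V) with hKd
  have hKconv : Convex ℝ K := (convex_convexHull ℝ V).closure
  have hKsub : K ⊆ Set.Icc 0 (fun j => ‖σ j * dist (y' j) (y'' j)‖ ^ Q) := by
    refine closure_minimal (convexHull_min ?_ (convex_Icc _ _)) isClosed_Icc
    rintro _ ⟨f, hf, rfl⟩
    refine ⟨fun j => ?_, fun j => ?_⟩
    · simp only [Pi.zero_apply]; positivity
    · have h1 : ‖f (y' j) - f (y'' j)‖ ≤ ‖dist (y' j) (y'' j)‖ := by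
        simpa [Real.dist_eq] using hf.1.dist_le_mul (y' j) (y'' j)
      simp only [norm_mul]
      gcongr
  have hKcomp : IsCompact K := isCompact_Icc.of_isClosed_subset isClosed_closure hKsub
  have hVK : V ⊆ K := (subset_convexHull ℝ V).trans subset_closure
  have hKne : K.Nonempty := by
    refine ⟨_, hVK ⟨0, ⟨?_, rfl⟩, rfl⟩⟩
    exact LipschitzWith.const' 0
  have hKb : ∀ v ∈ K, ∑ j, v j ^ α ≤ b := by
    have hcl : IsClosed {v : Fin m → ℝ | ∑ j, v j ^ α ≤ b} := by
      refine isClosed_le ?_ continuous_const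
      exact continuous_finsetSum _ fun j _ => (continuous_apply j).rpow_const fun _ => Or.inr hα.le
    exact fun v hv => closure_minimal (fun v hv => hb v hv) hcl hv
  have main : ∀ ε : ℝ, 0 < ε → mixedNorm y₀ s p σ y' y'' ≤
      (ENNReal.ofReal (b + ∑ _j : Fin m, ε ^ α)) ^ (1 / P) := by
    intro ε hε
    obtain ⟨u, hu, humax⟩ := hKcomp.exists_isMaxOn hKne
      (f := fun v : Fin m → ℝ => ∑ j, (v j + ε) ^ α) (Continuous.continuousOn
        (continuous_finsetSum _ fun j _ =>
          ((continuous_apply j).add continuous_const).rpow_const fun _ => Or.inr hα.le))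
    have hu0 : ∀ j, 0 ≤ u j := (hKsub hu).1
    have hpos : ∀ j, 0 < u j + ε := fun j => by have := hu0 j; linarith
    have hg : ∀ v ∈ K, ∑ j, v j * (u j + ε) ^ (α - 1) ≤ ∑ j, (u j + ε) ^ α := fun v hv =>
      grad_ineq hα hε hKconv (fun v hv => (hKsub hv).1) hu hv (fun z hz => humax hz)
    have hΦ : ∑ j, (u j + ε) ^ α ≤ b + ∑ _j : Fin m, ε ^ α := by
      calc _ ≤ ∑ j, (u j ^ α + ε ^ α) :=
            Finset.sum_le_sum fun j _ => Real.rpow_add_le_add_rpow (hu0 j) hε.le hα.le hα1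
        _ ≤ _ := by rw [Finset.sum_add_distrib]; gcongr; exact hKb u hu
    have hτ : ∀ j, 0 < (u j + ε) ^ ((1 - α) / Q) := fun j => Real.rpow_pos_of_pos (hpos j) _
    refine (iInf₂_le (fun j => (u j + ε) ^ ((1 - α) / Q)) (fun j => (hτ j).ne')).trans ?_
    have e1 : MeasureTheory.eLpNorm (fun j => (u j + ε) ^ ((1 - α) / Q)) (conjIdx p s)
        MeasureTheory.Measure.count = (ENNReal.ofReal (∑ j, (u j + ε) ^ α)) ^ (1 / R) := by
      rw [eLpNorm_fin_real _ hcne0.ne' hcnet.ne, hRd]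
      congr 2
      refine Finset.sum_congr rfl fun j _ => ?_
      rw [Real.norm_of_nonneg (hτ j).le, ← Real.rpow_mul (hpos j).le, hexp2]
    have e2 : weakNorm y₀ s (fun j => σ j / (u j + ε) ^ ((1 - α) / Q)) y' y'' ≤
        (ENNReal.ofReal (∑ j, (u j + ε) ^ α)) ^ (1 / Q) := by
      refine iSup₂_le fun f hf => ?_
      rw [eLpNorm_fin_real _ hs0 hst, hQd]
      refine ENNReal.rpow_le_rpow (ENNReal.ofReal_le_ofReal ?_) (by positivity)
      refine le_trans (le_of_eq ?_) (hg _ (hVK ⟨f, hf, rfl⟩))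
      refine Finset.sum_congr rfl fun j _ => ?_
      rw [div_mul_eq_mul_div, norm_div, Real.div_rpow (norm_nonneg _) (norm_nonneg _),
        Real.norm_of_nonneg (hτ j).le, ← Real.rpow_mul (hpos j).le, div_mul_cancel₀ _ hQ.ne',
        div_eq_mul_inv, ← Real.rpow_neg (hpos j).le, neg_sub]
    calc _ ≤ (ENNReal.ofReal (∑ j, (u j + ε) ^ α)) ^ (1 / R) *
          (ENNReal.ofReal (∑ j, (u j + ε) ^ α)) ^ (1 / Q) := mul_le_mul' e1.le e2
      _ = (ENNReal.ofReal (∑ j, (u j + ε) ^ α)) ^ (1 / P) := by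
          rw [← ENNReal.rpow_add_of_nonneg _ _ (by positivity) (by positivity), hexp]
      _ ≤ _ := ENNReal.rpow_le_rpow (ENNReal.ofReal_le_ofReal hΦ) (by positivity)
  have h3 : Continuous (fun ε : ℝ => (ENNReal.ofReal (b + ∑ _j : Fin m, ε ^ α)) ^ (1 / P)) := by
    refine ENNReal.continuous_rpow_const.comp (ENNReal.continuous_ofReal.comp ?_)
    refine continuous_const.add (continuous_finsetSum _ fun j _ => ?_)
    exact continuous_id.rpow_const fun _ => Or.inr hα.le
  have h4 := ge_of_tendsto ((h3.tendsto 0).mono_left (nhdsWithin_le_nhds (s := Set.Ioi 0)))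
    (Filter.eventually_of_mem self_mem_nhdsWithin fun ε hε => main ε hε)
  refine h4.trans (le_of_eq ?_)
  rw [Real.zero_rpow hα.ne', Finset.sum_const_zero, add_zero, ← hbd,
    ← ENNReal.ofReal_rpow_of_nonneg ENNReal.toReal_nonneg hP.le, ENNReal.ofReal_toReal hB,
    one_div, ENNReal.rpow_rpow_inv hP.ne']

end Dat

lemma Dat.mixed_le {Y : Type*} [MetricSpace Y] {y₀ : Y} {s p : ℝ≥0∞} (hs : 1 ≤ s) (hp : 0 < p)
    (hps : p ≤ s) {m : ℕ}
    (σ : Fin m → ℝ) (y' y'' : Fin m → Y) {B : ℝ≥0∞}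
    (h : ∀ D : Dat Y y₀, strongNorm p σ ((D.w hs).T ∘ y') ((D.w hs).T ∘ y'') ≤ B) :
    mixedNorm y₀ s p σ y' y'' ≤ B := by
  rcases eq_or_ne B ∞ with rfl | hB
  · exact le_top
  rcases hps.eq_or_lt with rfl | hlt
  · exact Dat.mixed_le_self hs σ y' y'' h
  · rcases eq_or_ne s ∞ with rfl | hst
    · exact Dat.mixed_le_top hs hp.ne' hlt.ne σ y' y'' h
    · exact Dat.mixed_le_main hs hp.ne' hlt hst σ y' y'' hB h

/-- let `1 ≤ s ≤ ∞`, `0 < p ≤ s`, `0 < r ≤ p`. If `S : X → Y` is Lipschitz and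
for every Banach space `F` and every Lipschitz `(p,m^L(s;p))`-summing map `T : Y → F` the
composition `T ∘ S` is Lipschitz `(p,m^L(r;r))`-summing, then `S` is Lipschitz
`(m^L(s;p),r)`-summing, and `π^L_{(m^L(s;p),r)}(S)` is the supremum of
`π^L_{(p,m^L(r;r))}(T ∘ S)` over all such `T` with `π^L_{(p,m^L(s;p))}(T) ≤ 1`. -/
theorem stmt7 {X Y : Type*} [MetricSpace X] [MetricSpace Y] (x₀ : X) (y₀ : Y)
    (s p r : ℝ≥0∞) (hs : 1 ≤ s) (hp : 0 < p) (hps : p ≤ s) (hr : 0 < r) (hrp : r ≤ p)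
    (S : X → Y) (K : ℝ≥0) (hS : LipschitzWith K S)
    (h : ∀ w : BanachMap Y, (∃ L : ℝ≥0, LipschitzWith L w.T) →
      LipPMixed y₀ p s p w.T → LipPMixed x₀ p r r (w.T ∘ S)) :
    LipMixedP x₀ y₀ s p r S ∧
    lipMixedPNorm x₀ y₀ s p r S =
      ⨆ (w : BanachMap Y) (_ : (∃ L : ℝ≥0, LipschitzWith L w.T) ∧
          LipPMixed y₀ p s p w.T ∧ lipPMixedNorm y₀ p s p w.T ≤ 1),
        lipPMixedNorm x₀ p r r (w.T ∘ S) := by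
  have hwt : ∀ (m : ℕ) (σ : Fin m → ℝ) (x' x'' : Fin m → X), weakNorm x₀ r σ x' x'' ≠ ∞ :=
    fun m σ x' x'' => ((weakNorm_le_strongNorm x₀ r σ x' x'').trans_lt
      (strongNorm_lt_top r σ x' x'')).ne
  have hfin : ∃ C : ℝ≥0, ∀ (D : Dat Y y₀) (m : ℕ) (σ : Fin m → ℝ) (x' x'' : Fin m → X),
      strongNorm p σ ((D.w hs).T ∘ S ∘ x') ((D.w hs).T ∘ S ∘ x'') ≤ C * weakNorm x₀ r σ x' x'' := by
    by_contra hcon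
    push Not at hcon
    choose D m σ x' x'' hD using fun k : ℕ => hcon ((2 : ℝ≥0) ^ (k + 1) * k)
    obtain ⟨C, hC⟩ := h ((Dat.glue D).w hs) ⟨1, (Dat.glue D).lip hs⟩ ((Dat.glue D).lipPMixed hs hps)
    obtain ⟨k, hk⟩ := exists_nat_ge C
    have h1 := Dat.strong_glue_le D (p := p) hs k (σ k) (S ∘ x' k) (S ∘ x'' k)
    have h2 := hC (m k) (σ k) (x' k) (x'' k)
    rw [mixedNorm_self] at h2
    refine absurd (hD k) (not_lt.2 (h1.trans ?_))
    rw [ENNReal.coe_mul, mul_assoc]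
    refine mul_le_mul' (by simp) (h2.trans ?_)
    gcongr
  have hle : lipMixedPNorm x₀ y₀ s p r S ≤
      ⨆ (w : BanachMap Y) (_ : (∃ L : ℝ≥0, LipschitzWith L w.T) ∧
          LipPMixed y₀ p s p w.T ∧ lipPMixedNorm y₀ p s p w.T ≤ 1),
        lipPMixedNorm x₀ p r r (w.T ∘ S) := by
    refine sInf_le fun m σ x' x'' => Dat.mixed_le hs hp hps _ _ _ fun D => ?_
    have h1 := le_iSup₂ (f := fun (w : BanachMap Y) (_ : (∃ L : ℝ≥0, LipschitzWith L w.T) ∧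
          LipPMixed y₀ p s p w.T ∧ lipPMixedNorm y₀ p s p w.T ≤ 1) =>
        lipPMixedNorm x₀ p r r (w.T ∘ S)) (D.w hs)
        ⟨⟨1, D.lip hs⟩, D.lipPMixed hs hps, D.lipPMixedNorm_le hs hps⟩
    refine le_trans ?_ (mul_le_mul_left h1 _)
    obtain ⟨C, hC⟩ := h (D.w hs) ⟨1, D.lip hs⟩ (D.lipPMixed hs hps)
    refine le_sInf_mul (hwt m σ x' x'') le_rfl (fun C hC => ?_)
      (ne_top_of_le_ne_top ENNReal.coe_ne_top (sInf_le hC))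
    have := hC m σ x' x''
    rwa [mixedNorm_self] at this
  refine ⟨?_, le_antisymm hle ?_⟩
  · obtain ⟨C, hC⟩ := hfin
    exact ⟨C, fun m σ x' x'' => Dat.mixed_le hs hp hps _ _ _ fun D => hC D m σ x' x''⟩
  · refine iSup₂_le fun w hw => le_sInf fun C hC => sInf_le fun m σ x' x'' => ?_
    rw [mixedNorm_self]
    refine le_trans ?_ (hC m σ x' x'')
    rw [← one_mul (mixedNorm y₀ _ _ _ _ _)]
    have hmt : mixedNorm y₀ s p σ (S ∘ x') (S ∘ x'') ≠ ∞ := by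
      refine ne_top_of_le_ne_top ?_ (iInf₂_le (fun _ => (1 : ℝ)) (fun _ => one_ne_zero))
      refine ENNReal.mul_ne_top ?_ ?_
      · exact (MeasureTheory.eLpNorm_count_lt_top_of_lt fun _ => enorm_lt_top).ne
      · exact ((weakNorm_le_strongNorm ..).trans_lt (strongNorm_lt_top ..)).ne
    exact le_sInf_mul hmt hw.2.2 (fun C hC => hC m σ (S ∘ x') (S ∘ x'')) ENNReal.one_ne_top
end
end

section
/- Let X and Y be pointed metric spaces, 1 ≤ s ≤ ∞, 0 < p ≤ s and p ≥ r > 0. If S : X → Y is a Lipschitz map such that for every Banach space F and every Lipschitz (s,m^L(s;s))-summing map T : Y → F the composition T ∘ S is Lipschitz (p,m^L(r;r))-summing, then S is Lipschitz (m^L(s;p),r)-summing and π^L_{(m^L(s;p),r)}(S) = sup { π^L_{(p,m^L(r;r))}(T ∘ S) : F a Banach space, T : Y → F Lipschitz (s,m^L(s;s))-summing with π^L_{(s,m^L(s;s))}(T) ≤ 1 }. -/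
open scoped ENNReal NNReal

noncomputable section

open MeasureTheory Finset

theorem aux_elp {m : ℕ} (f : Fin m → ℝ) {q : ℝ≥0∞} (h0 : q ≠ 0) (ht : q ≠ ⊤) :
    eLpNorm f q Measure.count =
      ENNReal.ofReal ((∑ j, |f j| ^ q.toReal) ^ (1 / q.toReal)) := by
  have hq : 0 < q.toReal := ENNReal.toReal_pos h0 ht
  rw [eLpNorm_eq_lintegral_rpow_enorm_toReal h0 ht, lintegral_count, tsum_fintype,
    ← ENNReal.ofReal_rpow_of_nonneg (by positivity) (by positivity),
    ENNReal.ofReal_sum_of_nonneg (by intros; positivity)]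
  congr 1
  refine Finset.sum_congr rfl fun j _ => ?_
  rw [← ENNReal.ofReal_rpow_of_nonneg (by positivity) hq.le, Real.enorm_eq_ofReal_abs]

theorem aux_holderTriple {p s : ℝ≥0∞} (hps : p ≤ s) :
    ENNReal.HolderTriple (conjIdx p s) s p := by
  constructor
  unfold conjIdx
  rw [inv_inv, one_div, one_div]
  exact tsub_add_cancel_of_le (ENNReal.inv_le_inv.2 hps)

theorem aux_holder {m : ℕ} {p s : ℝ≥0∞} (hps : p ≤ s) (τ g : Fin m → ℝ) :
    eLpNorm (fun j => τ j * g j) p Measure.count ≤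
      eLpNorm τ (conjIdx p s) Measure.count * eLpNorm g s Measure.count := by
  have := aux_holderTriple hps
  exact eLpNorm_smul_le_mul_eLpNorm (f := g) (φ := τ) (r := p)
    (Measurable.of_discrete.aestronglyMeasurable) (Measurable.of_discrete.aestronglyMeasurable)

theorem aux_conj_self (s : ℝ≥0∞) : conjIdx s s = ⊤ := by
  simp [conjIdx]

theorem aux_mixed_self {X : Type*} [MetricSpace X] (x₀ : X) (s : ℝ≥0∞) {m : ℕ}
    (σ : Fin m → ℝ) (x' x'' : Fin m → X) :
    mixedNorm x₀ s s σ x' x'' = weakNorm x₀ s σ x' x'' := by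
  apply le_antisymm
  · refine (iInf₂_le (fun _ => 1) (by simp)).trans ?_
    rw [aux_conj_self]
    simp only [div_one]
    refine (mul_le_mul_left ?_ _).trans (one_mul _).le
    rw [eLpNorm_exponent_top]
    simp
  · refine le_iInf₂ fun τ hτ => ?_
    refine iSup₂_le fun f hf => ?_
    have h1 := aux_holder (le_refl s) τ (fun j => σ j / τ j * (f (x' j) - f (x'' j)))
    have h2 : (fun j => τ j * (σ j / τ j * (f (x' j) - f (x'' j)))) =
        fun j => σ j * (f (x' j) - f (x'' j)) := by
      funext j
      have := hτ j
      field_simp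
    rw [h2] at h1
    refine h1.trans ?_
    gcongr
    exact le_iSup₂ (f := fun f (_ : f ∈ dualBall X x₀) => eLpNorm (fun j => σ j / τ j * (f (x' j) - f (x'' j))) s Measure.count) f hf

theorem aux_dual_le {X : Type*} [MetricSpace X] {x₀ : X} {f : X → ℝ} (hf : f ∈ dualBall X x₀)
    (a b : X) : |f a - f b| ≤ dist a b := by
  have := hf.1.dist_le_mul a b
  simpa [Real.dist_eq] using this

theorem aux_weak_le_strong {X : Type*} [MetricSpace X] (x₀ : X) (s : ℝ≥0∞) {m : ℕ}
    (σ : Fin m → ℝ) (x' x'' : Fin m → X) :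
    weakNorm x₀ s σ x' x'' ≤ strongNorm s σ x' x'' := by
  refine iSup₂_le fun f hf => ?_
  refine eLpNorm_mono fun j => ?_
  rw [norm_mul, norm_mul, Real.norm_eq_abs (f _ - _), Real.norm_of_nonneg dist_nonneg]
  gcongr
  exact aux_dual_le hf _ _

theorem aux_strong_lt_top {X : Type*} [MetricSpace X] (s : ℝ≥0∞) {m : ℕ}
    (σ : Fin m → ℝ) (x' x'' : Fin m → X) : strongNorm s σ x' x'' ≠ ⊤ :=
  (eLpNorm_count_lt_top_of_lt (fun _ => enorm_lt_top)).ne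

theorem aux_weak_ne_top {X : Type*} [MetricSpace X] (x₀ : X) (s : ℝ≥0∞) {m : ℕ}
    (σ : Fin m → ℝ) (x' x'' : Fin m → X) : weakNorm x₀ s σ x' x'' ≠ ⊤ :=
  ne_top_of_le_ne_top (aux_strong_lt_top s σ x' x'') (aux_weak_le_strong x₀ s σ x' x'')

theorem aux_norm_spec {X Y : Type*} [MetricSpace X] [MetricSpace Y] {x₀ : X}
    {p r : ℝ≥0∞} {T : X → Y} {C : ℝ≥0∞} (hC : lipPMixedNorm x₀ p r r T ≤ C) (hCt : C ≠ ⊤)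
    {m : ℕ} (σ : Fin m → ℝ) (x' x'' : Fin m → X) :
    strongNorm p σ (T ∘ x') (T ∘ x'') ≤ C * weakNorm x₀ r σ x' x'' := by
  refine le_trans ?_ (mul_le_mul_left hC _)
  unfold lipPMixedNorm
  by_cases h0 : weakNorm x₀ r σ x' x'' = 0
  · have h1 : sInf {C : ℝ≥0∞ | ∀ (m : ℕ) (σ : Fin m → ℝ) (x' x'' : Fin m → X),
      strongNorm p σ (T ∘ x') (T ∘ x'') ≤ C * mixedNorm x₀ r r σ x' x''} < ⊤ :=
      lt_of_le_of_lt hC hCt.lt_top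
    obtain ⟨D, hD, -⟩ := sInf_lt_iff.1 h1
    have h2 := hD m σ x' x''
    rw [aux_mixed_self, h0, mul_zero] at h2
    exact h2.trans zero_le
  rw [← ENNReal.div_le_iff h0 (aux_weak_ne_top x₀ r σ x' x'')]
  refine le_sInf fun C hC => ?_
  rw [ENNReal.div_le_iff h0 (aux_weak_ne_top x₀ r σ x' x''), ← aux_mixed_self]
  exact hC m σ x' x''

theorem aux_lip {Y F : Type*} [MetricSpace Y] [MetricSpace F] {y₀ : Y} {s : ℝ≥0∞} (hs : s ≠ 0)
    {T : Y → F} {C : ℝ≥0} (hT : ∀ (m : ℕ) (σ : Fin m → ℝ) (x' x'' : Fin m → Y),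
      strongNorm s σ (T ∘ x') (T ∘ x'') ≤ C * weakNorm y₀ s σ x' x'') : LipschitzWith C T := by
  intro a b
  have h1 : ∀ {Z : Type _} [MetricSpace Z] (u v : Z),
      strongNorm s (fun _ : Fin 1 => 1) (fun _ => u) (fun _ => v) = edist u v := by
    intro Z _ u v
    unfold strongNorm
    rw [eLpNorm_const _ hs (by simp)]
    simp [edist_dist, Real.enorm_eq_ofReal_abs]
  have h1' : ∀ {Z : Type _} [MetricSpace Z] (u v : Z),
      strongNorm s (fun _ : Fin 1 => 1) (fun _ => u) (fun _ => v) = edist u v := by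
    intro Z _ u v
    unfold strongNorm
    rw [eLpNorm_const _ hs (by simp)]
    simp [edist_dist, Real.enorm_eq_ofReal_abs]
  have h2 := hT 1 (fun _ => 1) (fun _ => a) (fun _ => b)
  have h3 := aux_weak_le_strong y₀ s (fun _ : Fin 1 => 1) (fun _ => a) (fun _ => b)
  rw [h1] at h3
  calc edist (T a) (T b) = _ := (h1' _ _).symm
    _ ≤ _ := h2
    _ ≤ _ := by gcongr

theorem aux_sup_summing {Y : Type*} [MetricSpace Y] (y₀ : Y) {s : ℝ≥0∞} (hs : 1 ≤ s)
    {F : Type} [NormedAddCommGroup F] (T : Y → F)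
    (w : ℕ → BanachMap Y)
    (hw : ∀ n (m : ℕ) (σ : Fin m → ℝ) (x' x'' : Fin m → Y),
      strongNorm s σ ((w n).T ∘ x') ((w n).T ∘ x'') ≤ weakNorm y₀ s σ x' x'')
    (hwl : ∀ n, LipschitzWith 1 (w n).T)
    (hT : ∀ (a b : Y) (c : ℝ), 0 ≤ c → (∀ n, (1 / 2 : ℝ) ^ n * dist ((w n).T a) ((w n).T b) ≤ c) →
      dist (T a) (T b) ≤ c)
    {m : ℕ} (σ : Fin m → ℝ) (x' x'' : Fin m → Y) :
    strongNorm s σ (T ∘ x') (T ∘ x'') ≤ 2 * weakNorm y₀ s σ x' x'' := by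
  set W := weakNorm y₀ s σ x' x'' with hW
  have hcount : ∀ g : Fin m → ℝ, AEStronglyMeasurable g Measure.count :=
    fun g => Measurable.of_discrete.aestronglyMeasurable
  have key : ∀ N : ℕ, strongNorm s σ (T ∘ x') (T ∘ x'') ≤
      2 * W + ENNReal.ofReal ((1 / 2 : ℝ) ^ N) * strongNorm s σ x' x'' := by
    intro N
    let a : ℕ → Fin m → ℝ := fun n => (1 / 2 : ℝ) ^ n •
      fun j => σ j * dist ((w n).T (x' j)) ((w n).T (x'' j))
    let e : Fin m → ℝ := (1 / 2 : ℝ) ^ N • fun j => σ j * dist (x' j) (x'' j)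
    have hpt : ∀ j, dist (T (x' j)) (T (x'' j)) ≤
        ∑ n ∈ range N, (1 / 2 : ℝ) ^ n * dist ((w n).T (x' j)) ((w n).T (x'' j)) +
          (1 / 2 : ℝ) ^ N * dist (x' j) (x'' j) := by
      intro j
      refine hT _ _ _ (by positivity) fun n => ?_
      rcases lt_or_ge n N with h | h
      · have := Finset.single_le_sum (f := fun n => (1 / 2 : ℝ) ^ n *
          dist ((w n).T (x' j)) ((w n).T (x'' j))) (fun i _ => by positivity)
          (Finset.mem_range.2 h)
        have h2 : 0 ≤ (1 / 2 : ℝ) ^ N * dist (x' j) (x'' j) := by positivity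
        linarith
      · have h1 : (1 / 2 : ℝ) ^ n ≤ (1 / 2 : ℝ) ^ N :=
          pow_le_pow_of_le_one (by norm_num) (by norm_num) h
        have h2 : dist ((w n).T (x' j)) ((w n).T (x'' j)) ≤ dist (x' j) (x'' j) := by
          simpa using (hwl n).dist_le_mul (x' j) (x'' j)
        have h3 : 0 ≤ ∑ n ∈ range N, (1 / 2 : ℝ) ^ n *
            dist ((w n).T (x' j)) ((w n).T (x'' j)) :=
          Finset.sum_nonneg fun i _ => by positivity
        have h4 := mul_le_mul h1 h2 dist_nonneg (by positivity)
        linarith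
    have h1 : strongNorm s σ (T ∘ x') (T ∘ x'') ≤
        eLpNorm (∑ n ∈ range N, a n + e) s Measure.count := by
      refine eLpNorm_mono fun j => ?_
      have : (∑ n ∈ range N, a n + e) j = σ j *
        (∑ n ∈ range N, (1 / 2 : ℝ) ^ n * dist ((w n).T (x' j)) ((w n).T (x'' j)) +
          (1 / 2 : ℝ) ^ N * dist (x' j) (x'' j)) := by
        simp only [a, e, Pi.add_apply, Finset.sum_apply, Pi.smul_apply, smul_eq_mul, mul_add,
          Finset.mul_sum]
        congr 1
        · exact Finset.sum_congr rfl fun n _ => by ring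
        · ring
      rw [this, norm_mul, norm_mul]
      gcongr
      rw [Real.norm_of_nonneg dist_nonneg]
      exact (hpt j).trans (le_abs_self _)
    refine h1.trans ((eLpNorm_add_le (hcount _) (hcount _) hs).trans ?_)
    refine add_le_add ((eLpNorm_sum_le (fun i _ => hcount _) hs).trans ?_) ?_
    · calc ∑ n ∈ range N, eLpNorm (a n) s Measure.count
          ≤ ∑ n ∈ range N, (2⁻¹ : ℝ≥0∞) ^ n * W := by
            refine Finset.sum_le_sum fun n _ => ?_
            simp only [a]
            rw [eLpNorm_const_smul]
            refine mul_le_mul' (le_of_eq ?_) (hw n m σ x' x'')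
            rw [enorm_pow]
            congr 1
            rw [Real.enorm_eq_ofReal (by norm_num), one_div, ENNReal.ofReal_inv_of_pos (by norm_num)]
            simp
        _ = (∑ n ∈ range N, (2⁻¹ : ℝ≥0∞) ^ n) * W := by rw [Finset.sum_mul]
        _ ≤ 2 * W := by
            gcongr
            refine (ENNReal.sum_le_tsum _).trans ?_
            rw [ENNReal.tsum_geometric]
            simp
    · simp only [e]
      rw [eLpNorm_const_smul]
      rw [Real.enorm_eq_ofReal (by positivity)]
      rfl
  have hlim : Filter.Tendsto (fun N : ℕ => 2 * W + ENNReal.ofReal ((1 / 2 : ℝ) ^ N) * strongNorm s σ x' x'')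
      Filter.atTop (nhds (2 * W + ENNReal.ofReal 0 * strongNorm s σ x' x'')) := by
    refine tendsto_const_nhds.add (ENNReal.Tendsto.mul_const (ENNReal.tendsto_ofReal ?_)
      (Or.inr (aux_strong_lt_top s σ x' x'')))
    exact tendsto_pow_atTop_nhds_zero_of_lt_one (by norm_num) (by norm_num)
  simpa using ge_of_tendsto' hlim key

theorem aux_finite {X Y : Type*} [MetricSpace X] [MetricSpace Y] (x₀ : X) (y₀ : Y)
    (s p r : ℝ≥0∞) (hs : 1 ≤ s) 
    (S : X → Y) 
    (h : ∀ w : BanachMap Y, (∃ L : ℝ≥0, LipschitzWith L w.T) →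
      LipPMixed y₀ s s s w.T → LipPMixed x₀ p r r (w.T ∘ S)) :
      (⨆ (w : BanachMap Y) (_ : (∃ L : ℝ≥0, LipschitzWith L w.T) ∧
          LipPMixed y₀ s s s w.T ∧ lipPMixedNorm y₀ s s s w.T ≤ 1),
        lipPMixedNorm x₀ p r r (w.T ∘ S)) ≠ ⊤ := by
  intro htop
  have hs0 : s ≠ 0 := (lt_of_lt_of_le one_pos hs).ne'
  have : ∀ n : ℕ, ∃ w : BanachMap Y, ((∃ L : ℝ≥0, LipschitzWith L w.T) ∧
          LipPMixed y₀ s s s w.T ∧ lipPMixedNorm y₀ s s s w.T ≤ 1) ∧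
          (4 : ℝ≥0∞) ^ n < lipPMixedNorm x₀ p r r (w.T ∘ S) := by
    intro n
    have h1 : (4 : ℝ≥0∞) ^ n < ⊤ := ENNReal.pow_lt_top (by simp)
    rw [← htop] at h1
    simp only [lt_iSup_iff] at h1
    obtain ⟨w, hw, h2⟩ := h1
    exact ⟨w, hw, h2⟩
  choose w hw hbig using this
  have hw1 : ∀ n (m : ℕ) (σ : Fin m → ℝ) (x' x'' : Fin m → Y),
      strongNorm s σ ((w n).T ∘ x') ((w n).T ∘ x'') ≤ weakNorm y₀ s σ x' x'' := by
    intro n m σ x' x''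
    simpa using aux_norm_spec (hw n).2.2 (by simp) σ x' x''
  have hwl : ∀ n, LipschitzWith 1 (w n).T := by
    intro n
    refine aux_lip (y₀ := y₀) hs0 ?_
    simpa using hw1 n
  have hmem : ∀ y, Memℓp (fun n => ((1 / 2 : ℝ) ^ n • ((w n).T y - (w n).T y₀) : (w n).F)) ⊤ := by
    intro y
    refine memℓp_infty ⟨dist y y₀, ?_⟩
    rintro _ ⟨n, rfl⟩
    have h2 : dist ((w n).T y) ((w n).T y₀) ≤ dist y y₀ := by
      simpa using (hwl n).dist_le_mul y y₀
    have h1 : (1 / 2 : ℝ) ^ n ≤ 1 := pow_le_one₀ (by norm_num) (by norm_num)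
    simp only [norm_smul]
    rw [← dist_eq_norm, Real.norm_of_nonneg (by positivity)]
    calc _ ≤ 1 * dist y y₀ := mul_le_mul h1 h2 dist_nonneg (by norm_num)
      _ = _ := one_mul _
  let T : Y → lp (fun n => (w n).F) ⊤ := fun y => ⟨_, hmem y⟩
  have hsub : ∀ a b n, ‖(T a - T b) n‖ = (1 / 2 : ℝ) ^ n * dist ((w n).T a) ((w n).T b) := by
    intro a b n
    have : (T a - T b) n = (1 / 2 : ℝ) ^ n • ((w n).T a - (w n).T b) := by
      rw [lp.coeFn_sub, Pi.sub_apply]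
      simp only [T]
      rw [← smul_sub]
      congr 1
      abel
    rw [this, norm_smul, ← dist_eq_norm, Real.norm_of_nonneg (by positivity)]
  have hT1 : ∀ (a b : Y) (c : ℝ), 0 ≤ c → (∀ n, (1 / 2 : ℝ) ^ n * dist ((w n).T a) ((w n).T b) ≤ c) →
      dist (T a) (T b) ≤ c := by
    intro a b c hc hn
    rw [dist_eq_norm]
    refine lp.norm_le_of_forall_le hc fun n => ?_
    rw [hsub]
    exact hn n
  have hT2 : ∀ (a b : Y) n, (1 / 2 : ℝ) ^ n * dist ((w n).T a) ((w n).T b) ≤ dist (T a) (T b) := by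
    intro a b n
    rw [dist_eq_norm (T a), ← hsub]
    exact lp.norm_apply_le_norm (by simp) _ _
  have hTs : ∀ (m : ℕ) (σ : Fin m → ℝ) (x' x'' : Fin m → Y),
      strongNorm s σ (T ∘ x') (T ∘ x'') ≤ (2 : ℝ≥0) * weakNorm y₀ s σ x' x'' :=
    fun m σ x' x'' => aux_sup_summing y₀ hs T w hw1 hwl hT1 σ x' x''
  obtain ⟨C, hC⟩ := h ⟨lp (fun n => (w n).F) ⊤, T⟩ ⟨2, aux_lip hs0 hTs⟩
    ⟨2, fun m σ x' x'' => by rw [aux_mixed_self]; exact hTs m σ x' x''⟩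
  simp only at hC
  have hb : ∀ n, lipPMixedNorm x₀ p r r ((w n).T ∘ S) ≤ 2 ^ n * C := by
    intro n
    refine sInf_le fun m σ x' x'' => ?_
    rw [mul_assoc]
    have h1 := hC m σ x' x''
    refine le_trans ?_ (mul_le_mul_right h1 _)
    have h3 : (2 : ℝ≥0∞) ^ n = ‖(2 : ℝ) ^ n‖ₑ := by
      rw [enorm_pow, Real.enorm_eq_ofReal (by norm_num)]; simp
    unfold strongNorm
    rw [h3, ← eLpNorm_const_smul]
    refine eLpNorm_mono fun j => ?_
    simp only [Pi.smul_apply, smul_eq_mul, norm_mul, Function.comp]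
    rw [mul_left_comm]
    gcongr
    rw [Real.norm_of_nonneg dist_nonneg, Real.norm_of_nonneg dist_nonneg,
      Real.norm_of_nonneg (by positivity)]
    have h4 := hT2 (S (x' j)) (S (x'' j)) n
    rw [one_div, inv_pow, inv_mul_le_iff₀ (by positivity)] at h4
    exact h4
  obtain ⟨n, hn⟩ := pow_unbounded_of_one_lt (C : ℝ≥0) (one_lt_two)
  have h5 := (hbig n).trans_le (hb n)
  have h6 : (4 : ℝ≥0) ^ n < 2 ^ n * C := by exact_mod_cast h5
  have h7 : (4 : ℝ≥0) ^ n = 2 ^ n * 2 ^ n := by rw [← mul_pow]; norm_num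
  rw [h7] at h6
  exact absurd (lt_of_mul_lt_mul_left h6 (by positivity)) (not_lt.2 hn.le)

theorem aux_key {m : ℕ} (A : Set (Fin m → ℝ)) (hne : A.Nonempty)
    (hnn : ∀ a ∈ A, ∀ j, 0 ≤ a j) (hbd : Bornology.IsBounded A) {θ M : ℝ}
    (h0 : 0 < θ) (h1 : θ < 1)
    (hM : ∀ b ∈ convexHull ℝ A, ∑ j, b j ^ θ ≤ M) {δ : ℝ} (hδ : 0 < δ) :
    ∃ c : Fin m → ℝ, (∀ j, 0 < c j) ∧ ∑ j, c j ^ θ ≤ M + m * δ ^ θ ∧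
      ∀ a ∈ A, ∑ j, a j * c j ^ (θ - 1) ≤ M + m * δ ^ θ := by
  set B := closure (convexHull ℝ A) with hB
  have hBc : IsCompact B :=
    Metric.isCompact_of_isClosed_isBounded isClosed_closure
      ((isBounded_convexHull.2 hbd).closure)
  have hBconv : Convex ℝ B := (convex_convexHull ℝ A).closure
  have hAB : A ⊆ B := (subset_convexHull ℝ A).trans subset_closure
  have hnnB : ∀ b ∈ B, ∀ j, 0 ≤ b j := by
    have hcl : IsClosed {b : Fin m → ℝ | 0 ≤ b} := isClosed_Ici
    have hcv : Convex ℝ {b : Fin m → ℝ | 0 ≤ b} := convex_Ici (0 : Fin m → ℝ)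
    have : B ⊆ {b : Fin m → ℝ | 0 ≤ b} :=
      closure_minimal (convexHull_min (fun a ha => hnn a ha) hcv) hcl
    exact fun b hb j => this hb j
  have hMB : ∀ b ∈ B, ∑ j, b j ^ θ ≤ M := by
    have hcl : IsClosed {b : Fin m → ℝ | ∑ j, b j ^ θ ≤ M} := by
      refine isClosed_le ?_ continuous_const
      refine continuous_finsetSum _ fun j _ => ?_
      exact (continuous_apply j).rpow_const fun _ => Or.inr h0.le
    exact fun b hb => closure_minimal (fun b hb => hM b hb) hcl hb
  have hgc : ContinuousOn (fun b : Fin m → ℝ => ∑ j, (b j + δ) ^ θ) B := by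
    refine Continuous.continuousOn ?_
    refine continuous_finsetSum _ fun j _ => ?_
    exact ((continuous_apply j).add continuous_const).rpow_const fun _ => Or.inr h0.le
  obtain ⟨b, hb, hmax⟩ := hBc.exists_isMaxOn (hne.mono hAB) hgc
  have hpos : ∀ j, 0 < b j + δ := fun j => by linarith [hnnB b hb j]
  have hsum : ∑ j, (b j + δ) ^ θ ≤ M + m * δ ^ θ := by
    calc ∑ j, (b j + δ) ^ θ ≤ ∑ j, (b j ^ θ + δ ^ θ) :=
          Finset.sum_le_sum fun j _ => Real.rpow_add_le_add_rpow (hnnB b hb j) hδ.le h0.le h1.le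
      _ ≤ _ := by
          rw [Finset.sum_add_distrib]
          simpa using hMB b hb
  refine ⟨fun j => b j + δ, hpos, hsum, fun a ha => ?_⟩
  have hder : HasFDerivAt (fun b : Fin m → ℝ => ∑ j, (b j + δ) ^ θ)
      (∑ j, (θ * (b j + δ) ^ (θ - 1)) • (ContinuousLinearMap.proj j : (Fin m → ℝ) →L[ℝ] ℝ)) b := by
    refine HasFDerivAt.fun_sum fun j _ => ?_
    have h3 : HasFDerivAt (fun b : Fin m → ℝ => b j + δ)
        (ContinuousLinearMap.proj j : (Fin m → ℝ) →L[ℝ] ℝ) b :=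
      (hasFDerivAt_apply j b).add_const δ
    exact h3.rpow_const (Or.inl (hpos j).ne')
  have h4 := (hmax.localize).hasFDerivWithinAt_nonpos hder.hasFDerivWithinAt
    (sub_mem_posTangentConeAt_of_segment_subset (hBconv.segment_subset hb (hAB ha)))
  simp only [_root_.sum_apply, smul_apply,
    ContinuousLinearMap.proj_apply, Pi.sub_apply, smul_eq_mul] at h4
  have h5 : ∑ j, a j * (b j + δ) ^ (θ - 1) ≤ ∑ j, b j * (b j + δ) ^ (θ - 1) := by
    have h6 : ∑ j, θ * (b j + δ) ^ (θ - 1) * (a j - b j) =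
      θ * (∑ j, a j * (b j + δ) ^ (θ - 1) - ∑ j, b j * (b j + δ) ^ (θ - 1)) := by
      rw [← Finset.sum_sub_distrib, Finset.mul_sum]
      exact Finset.sum_congr rfl fun j _ => by ring
    rw [h6] at h4
    by_contra hcon
    push Not at hcon
    have := mul_pos h0 (sub_pos.2 hcon)
    linarith
  refine h5.trans (le_trans (Finset.sum_le_sum fun j _ => ?_) hsum)
  calc b j * (b j + δ) ^ (θ - 1) ≤ (b j + δ) * (b j + δ) ^ (θ - 1) := by
        have := hpos j
        gcongr
        linarith
    _ = (b j + δ) ^ θ := by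
        rw [Real.rpow_sub_one (hpos j).ne']
        have := (hpos j).ne'
        field_simp

def auxGood {Y F : Type*} [MetricSpace Y] [MetricSpace F] (y₀ : Y) (s : ℝ≥0∞) (T : Y → F) : Prop :=
  ∀ (m : ℕ) (σ : Fin m → ℝ) (x' x'' : Fin m → Y),
    strongNorm s σ (T ∘ x') (T ∘ x'') ≤ weakNorm y₀ s σ x' x''

theorem aux_le_weak {Y : Type*} [MetricSpace Y] {y₀ : Y} {f : Y → ℝ} (hf : f ∈ dualBall Y y₀)
    (s : ℝ≥0∞) {m : ℕ} (σ : Fin m → ℝ) (x' x'' : Fin m → Y) :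
    eLpNorm (fun j => σ j * (f (x' j) - f (x'' j))) s Measure.count ≤ weakNorm y₀ s σ x' x'' :=
  le_iSup₂ (f := fun f (_ : f ∈ dualBall Y y₀) =>
    eLpNorm (fun j => σ j * (f (x' j) - f (x'' j))) s Measure.count) f hf

theorem aux_single_eq {Y : Type*} [MetricSpace Y] (f : Y → ℝ)
    (s : ℝ≥0∞) {m : ℕ} (σ : Fin m → ℝ) (x' x'' : Fin m → Y) :
    strongNorm s σ (f ∘ x') (f ∘ x'') =
    eLpNorm (fun j => σ j * (f (x' j) - f (x'' j))) s Measure.count := by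
  refine eLpNorm_congr_norm_ae (Filter.Eventually.of_forall fun j => ?_)
  simp [Real.dist_eq]

theorem aux_good_single {Y : Type*} [MetricSpace Y] {y₀ : Y} {f : Y → ℝ} (hf : f ∈ dualBall Y y₀)
    (s : ℝ≥0∞) : auxGood y₀ s f := by
  intro m σ x' x''
  rw [aux_single_eq]
  exact aux_le_weak hf s σ x' x''

theorem aux_good_top {Y F : Type*} [MetricSpace Y] [MetricSpace F] (y₀ : Y) {T : Y → F}
    (hT : LipschitzWith 1 T) : auxGood y₀ ⊤ T := by
  intro m σ x' x''
  unfold strongNorm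
  rw [eLpNorm_exponent_top, eLpNormEssSup_count]
  refine iSup_le fun j => ?_
  let f : Y → ℝ := fun y => dist y (x'' j) - dist y₀ (x'' j)
  have hf : f ∈ dualBall Y y₀ := by
    refine ⟨?_, by simp [f]⟩
    refine LipschitzWith.of_dist_le_mul fun a b => ?_
    simp only [f, Real.dist_eq, NNReal.coe_one, one_mul]
    rw [sub_sub_sub_cancel_right]
    exact abs_dist_sub_le a b (x'' j)
  refine le_trans ?_ (aux_le_weak hf ⊤ σ x' x'')
  refine le_trans ?_ (enorm_le_eLpNorm_count _ j (by simp))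
  rw [enorm_le_iff_norm_le, norm_mul, norm_mul]
  gcongr
  rw [Real.norm_of_nonneg dist_nonneg, Real.norm_of_nonneg (by simp [f])]
  simpa [f] using hT.dist_le_mul (x' j) (x'' j)

theorem aux_discrete {Y : Type*} [MetricSpace Y] (y₀ : Y) {s : ℝ≥0∞} [Fact (1 ≤ s)] (hs : s ≠ ⊤)
    {ι : Type} [Fintype ι] (w : ι → ℝ) (hw : ∀ i, 0 ≤ w i) (hw1 : ∑ i, w i = 1)
    (f : ι → Y → ℝ) (hf : ∀ i, f i ∈ dualBall Y y₀) :
    ∃ T : Y → PiLp s (fun _ : ι => ℝ), auxGood y₀ s T ∧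
      ∀ a b, dist (T a) (T b) ^ s.toReal = ∑ i, w i * |f i a - f i b| ^ s.toReal := by
  have hs0 : s ≠ 0 := (lt_of_lt_of_le one_pos (Fact.out : 1 ≤ s)).ne'
  have hQ : 0 < s.toReal := ENNReal.toReal_pos hs0 hs
  set Q := s.toReal with hQdef
  let T : Y → PiLp s (fun _ : ι => ℝ) := fun y => WithLp.toLp s (fun i => w i ^ (1 / Q) * f i y)
  have hT : ∀ a b, dist (T a) (T b) ^ Q = ∑ i, w i * |f i a - f i b| ^ Q := by
    intro a b
    rw [PiLp.dist_eq_sum hQ, one_div, Real.rpow_inv_rpow _ hQ.ne']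
    · refine Finset.sum_congr rfl fun i _ => ?_
      simp only [T, Real.dist_eq]
      rw [← mul_sub, abs_mul, Real.mul_rpow (abs_nonneg _) (abs_nonneg _),
        abs_of_nonneg (Real.rpow_nonneg (hw i) _), one_div, Real.rpow_inv_rpow (hw i) hQ.ne']
    · exact Finset.sum_nonneg fun i _ => Real.rpow_nonneg dist_nonneg _
  refine ⟨T, ?_, hT⟩
  intro m σ x' x''
  have hWt := aux_weak_ne_top y₀ s σ x' x''
  set W := weakNorm y₀ s σ x' x'' with hW
  have hfi : ∀ i, ∑ j, |σ j * (f i (x' j) - f i (x'' j))| ^ Q ≤ W.toReal ^ Q := by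
    intro i
    have h1 := aux_le_weak (hf i) s σ x' x''
    rw [aux_elp _ hs0 hs, ← hW, ENNReal.ofReal_le_iff_le_toReal hWt, one_div,
      Real.rpow_inv_le_iff_of_pos (Finset.sum_nonneg fun i _ => by positivity)
      ENNReal.toReal_nonneg hQ] at h1
    exact h1
  unfold strongNorm
  rw [aux_elp _ hs0 hs, ENNReal.ofReal_le_iff_le_toReal hWt, one_div,
      Real.rpow_inv_le_iff_of_pos (Finset.sum_nonneg fun i _ => by positivity)
      ENNReal.toReal_nonneg hQ]
  calc ∑ j, |σ j * dist ((T ∘ x') j) ((T ∘ x'') j)| ^ s.toReal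
      = ∑ j, ∑ i, w i * |σ j * (f i (x' j) - f i (x'' j))| ^ Q := by
        refine Finset.sum_congr rfl fun j _ => ?_
        rw [← hQdef, abs_mul, abs_of_nonneg dist_nonneg,
          Real.mul_rpow (abs_nonneg _) dist_nonneg]
        simp only [Function.comp]
        rw [hT, Finset.mul_sum]
        refine Finset.sum_congr rfl fun i _ => ?_
        rw [abs_mul, Real.mul_rpow (abs_nonneg _) (abs_nonneg _)]
        ring
    _ = ∑ i, w i * ∑ j, |σ j * (f i (x' j) - f i (x'' j))| ^ Q := by
        rw [Finset.sum_comm]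
        simp only [Finset.mul_sum]
    _ ≤ ∑ i, w i * W.toReal ^ Q :=
        Finset.sum_le_sum fun i _ => mul_le_mul_of_nonneg_left (hfi i) (hw i)
    _ = W.toReal ^ Q := by rw [← Finset.sum_mul, hw1, one_mul]

theorem aux_main_lt {Y : Type*} [MetricSpace Y] (y₀ : Y) {s p : ℝ≥0∞} (hs : 1 ≤ s)
    (hp : 0 < p) (hps : p < s) (hst : s ≠ ⊤) {m : ℕ} (σ : Fin m → ℝ) (z' z'' : Fin m → Y)
    {D : ℝ≥0∞} (hDt : D ≠ ⊤)
    (hD : ∀ w : BanachMap Y, auxGood y₀ s w.T → strongNorm p σ (w.T ∘ z') (w.T ∘ z'') ≤ D) :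
    mixedNorm y₀ s p σ z' z'' ≤ D := by
  have hs0 : s ≠ 0 := (lt_of_lt_of_le one_pos hs).ne'
  have hpt : p ≠ ⊤ := ne_top_of_lt hps
  have hP : 0 < p.toReal := ENNReal.toReal_pos hp.ne' hpt
  have hQ : 0 < s.toReal := ENNReal.toReal_pos hs0 hst
  have hPQ : p.toReal < s.toReal := (ENNReal.toReal_lt_toReal hpt hst).2 hps
  have hinv : s⁻¹ < p⁻¹ := ENNReal.inv_lt_inv.2 hps
  have hu0 : conjIdx p s ≠ 0 := by
    unfold conjIdx
    refine ENNReal.inv_ne_zero.2 (ne_top_of_le_ne_top ?_ tsub_le_self)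
    simpa using hp.ne'
  have hut : conjIdx p s ≠ ⊤ := by
    unfold conjIdx
    rw [one_div, one_div]
    exact ENNReal.inv_ne_top.2 (tsub_pos_of_lt hinv).ne'
  have hU : (conjIdx p s).toReal = (1 / p.toReal - 1 / s.toReal)⁻¹ := by
    unfold conjIdx
    rw [ENNReal.toReal_inv, ENNReal.toReal_sub_of_le (by simpa using hps.le) (by simpa using hp.ne')]
    simp
  set P := p.toReal with hPdef
  set Q := s.toReal with hQdef
  set u := conjIdx p s with hudef
  set U := u.toReal with hUdef
  have hUpos : 0 < U := ENNReal.toReal_pos hu0 hut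
  have hQP : 0 < Q - P := by linarith
  set θ := P / Q with hθ
  have hθ0 : 0 < θ := div_pos hP hQ
  have hθ1 : θ < 1 := (div_lt_one hQ).2 hPQ
  have hexp : (1 - θ) / Q * U = θ := by
    rw [hU, hθ]
    have : 1 / P - 1 / Q = (Q - P) / (P * Q) := by field_simp
    rw [this]
    field_simp
  have hexp2 : 1 / U + 1 / Q = 1 / P := by
    rw [hU]; simp
  let A : Set (Fin m → ℝ) := (fun f : Y → ℝ => fun j => |σ j * (f (z' j) - f (z'' j))| ^ Q) ''
    dualBall Y y₀
  have hA0 : A.Nonempty := by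
    refine Set.Nonempty.image _ ⟨fun _ => 0, ?_, rfl⟩
    exact LipschitzWith.const' 0
  have hAn : ∀ a ∈ A, ∀ j, 0 ≤ a j := by
    rintro _ ⟨f, hf, rfl⟩ j
    positivity
  have hAb : Bornology.IsBounded A := by
    refine (Metric.isBounded_Icc (0 : Fin m → ℝ)
      (fun j => |σ j * dist (z' j) (z'' j)| ^ Q)).subset ?_
    rintro _ ⟨f, hf, rfl⟩
    refine ⟨fun j => by positivity, fun j => ?_⟩
    simp only
    refine Real.rpow_le_rpow (abs_nonneg _) ?_ hQ.le
    rw [abs_mul, abs_mul, abs_of_nonneg (dist_nonneg (x := z' j))]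
    gcongr
    exact aux_dual_le hf _ _
  have hM : ∀ b ∈ convexHull ℝ A, ∑ j, b j ^ θ ≤ D.toReal ^ P := by
    intro b hb
    obtain ⟨ι, _, w, a, hw, hw1, ha, rfl⟩ := mem_convexHull_iff_exists_fintype.1 hb
    choose f hf hfa using ha
    have : Fact (1 ≤ s) := ⟨hs⟩
    obtain ⟨T, hT, hTd⟩ := aux_discrete y₀ hst w hw hw1 f hf
    have h1 := hD ⟨PiLp s (fun _ : ι => ℝ), T⟩ hT
    unfold strongNorm at h1
    rw [aux_elp _ hp.ne' hpt, ENNReal.ofReal_le_iff_le_toReal hDt, one_div,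
      Real.rpow_inv_le_iff_of_pos (Finset.sum_nonneg fun i _ => by positivity)
      ENNReal.toReal_nonneg hP] at h1
    refine le_trans (le_of_eq ?_) h1
    refine Finset.sum_congr rfl fun j _ => ?_
    have h2 : (∑ i, w i • a i) j = |σ j * dist (T (z' j)) (T (z'' j))| ^ Q := by
      rw [abs_mul, abs_of_nonneg (dist_nonneg (x := T (z' j))),
        Real.mul_rpow (abs_nonneg _) dist_nonneg, hTd, Finset.mul_sum, Finset.sum_apply]
      refine Finset.sum_congr rfl fun i _ => ?_
      rw [← hfa i]
      simp only [Pi.smul_apply, smul_eq_mul]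
      rw [abs_mul, Real.mul_rpow (abs_nonneg _) (abs_nonneg _)]
      ring
    rw [h2, ← Real.rpow_mul (abs_nonneg _), hθ, mul_div_cancel₀ _ hQ.ne']
    rfl
  have hmain : ∀ δ : ℝ, 0 < δ → mixedNorm y₀ s p σ z' z'' ≤
      ENNReal.ofReal ((D.toReal ^ P + m * δ ^ θ) ^ (1 / P)) := by
    intro δ hδ
    obtain ⟨c, hc, hc1, hc2⟩ := aux_key A hA0 hAn hAb hθ0 hθ1 hM hδ
    set N := D.toReal ^ P + m * δ ^ θ with hN
    have hN0 : 0 ≤ N := by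
      have : 0 ≤ D.toReal := ENNReal.toReal_nonneg
      positivity
    refine (iInf₂_le (fun j => c j ^ ((1 - θ) / Q)) (fun j => (Real.rpow_pos_of_pos (hc j) _).ne')).trans ?_
    rw [← hexp2, Real.rpow_add_of_nonneg hN0 (by positivity) (by positivity),
      ENNReal.ofReal_mul (by positivity)]
    refine mul_le_mul' ?_ (iSup₂_le fun f hf => ?_)
    · rw [← hudef, aux_elp _ hu0 hut]
      refine ENNReal.ofReal_le_ofReal (Real.rpow_le_rpow (Finset.sum_nonneg fun i _ => by positivity)
        (le_trans (le_of_eq ?_) hc1) (by positivity))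
      refine Finset.sum_congr rfl fun j _ => ?_
      rw [abs_of_pos (Real.rpow_pos_of_pos (hc j) _), ← Real.rpow_mul (hc j).le, ← hUdef, hexp]
    · rw [aux_elp _ hs0 hst]
      refine ENNReal.ofReal_le_ofReal (Real.rpow_le_rpow (Finset.sum_nonneg fun i _ => by positivity)
        (le_trans (le_of_eq ?_) (hc2 _ ⟨f, hf, rfl⟩)) (by positivity))
      refine Finset.sum_congr rfl fun j _ => ?_
      rw [← hQdef]
      have h3 := Real.rpow_pos_of_pos (hc j) ((1 - θ) / Q)
      have h4 : σ j / c j ^ ((1 - θ) / Q) * (f (z' j) - f (z'' j)) =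
        σ j * (f (z' j) - f (z'' j)) / c j ^ ((1 - θ) / Q) := by ring
      rw [h4, abs_div, abs_of_pos h3, Real.div_rpow (abs_nonneg _) h3.le,
        ← Real.rpow_mul (hc j).le, div_mul_cancel₀ _ hQ.ne', div_eq_mul_inv,
        ← Real.rpow_neg (hc j).le, neg_sub]
  have hlim : Filter.Tendsto (fun δ : ℝ => ENNReal.ofReal ((D.toReal ^ P + m * δ ^ θ) ^ (1 / P)))
      (nhdsWithin 0 (Set.Ioi 0))
      (nhds (ENNReal.ofReal ((D.toReal ^ P + m * (0 : ℝ) ^ θ) ^ (1 / P)))) := by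
    refine Filter.Tendsto.mono_left (Continuous.tendsto ?_ 0) nhdsWithin_le_nhds
    refine ENNReal.continuous_ofReal.comp (Continuous.rpow_const ?_ fun _ => Or.inr (by positivity))
    exact continuous_const.add (continuous_const.mul
      (continuous_id.rpow_const fun _ => Or.inr hθ0.le))
  have h5 := ge_of_tendsto hlim (Filter.eventually_of_mem self_mem_nhdsWithin fun δ hδ => hmain δ hδ)
  rw [Real.zero_rpow hθ0.ne', mul_zero, add_zero, one_div,
    Real.rpow_rpow_inv ENNReal.toReal_nonneg hP.ne', ENNReal.ofReal_toReal hDt] at h5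
  exact h5

theorem aux_main_top {Y : Type*} [MetricSpace Y] (y₀ : Y) {p : ℝ≥0∞}
    (hp : 0 < p) (hpt : p ≠ ⊤) {m : ℕ} (σ : Fin m → ℝ) (z' z'' : Fin m → Y)
    {D : ℝ≥0∞}
    (hD : ∀ w : BanachMap Y, auxGood y₀ ⊤ w.T → strongNorm p σ (w.T ∘ z') (w.T ∘ z'') ≤ D) :
    mixedNorm y₀ ⊤ p σ z' z'' ≤ D := by
  have hP : 0 < p.toReal := ENNReal.toReal_pos hp.ne' hpt
  have hconj : conjIdx p ⊤ = p := by simp [conjIdx]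
  let T : Y → (Fin m → ℝ) := fun y i => dist y (z'' i)
  have hTl : LipschitzWith 1 T := by
    refine LipschitzWith.of_dist_le_mul fun a b => ?_
    rw [NNReal.coe_one, one_mul]
    refine (dist_pi_le_iff dist_nonneg).2 fun i => ?_
    exact abs_dist_sub_le a b (z'' i)
  have hTd : ∀ j, dist (z' j) (z'' j) ≤ dist (T (z' j)) (T (z'' j)) := by
    intro j
    have := dist_le_pi_dist (T (z' j)) (T (z'' j)) j
    simpa [T, Real.dist_eq] using this
  have h1 : strongNorm p σ z' z'' ≤ D := by
    refine le_trans ?_ (hD ⟨Fin m → ℝ, T⟩ (aux_good_top y₀ hTl))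
    refine eLpNorm_mono fun j => ?_
    rw [norm_mul, norm_mul, Real.norm_of_nonneg dist_nonneg, Real.norm_of_nonneg dist_nonneg]
    gcongr
    exact hTd j
  refine le_trans ?_ h1
  have hmain : ∀ δ : ℝ, 0 < δ → mixedNorm y₀ ⊤ p σ z' z'' ≤
      ENNReal.ofReal ((∑ j, max |σ j * dist (z' j) (z'' j)| δ ^ p.toReal) ^ (1 / p.toReal)) := by
    intro δ hδ
    have hpos : ∀ j, 0 < max |σ j * dist (z' j) (z'' j)| δ := fun j => lt_max_of_lt_right hδ
    refine (iInf₂_le (fun j => max |σ j * dist (z' j) (z'' j)| δ) (fun j => (hpos j).ne')).trans ?_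
    rw [hconj, aux_elp _ hp.ne' hpt]
    simp only [abs_of_pos (hpos _)]
    refine (mul_le_mul_right ?_ _).trans (mul_one _).le
    refine iSup₂_le fun f hf => ?_
    rw [eLpNorm_exponent_top, eLpNormEssSup_count]
    refine iSup_le fun j => ?_
    rw [Real.enorm_eq_ofReal_abs]
    refine (ENNReal.ofReal_le_ofReal ?_).trans ENNReal.ofReal_one.le
    rw [div_mul_eq_mul_div, abs_div, abs_of_pos (hpos j), div_le_one (hpos j)]
    refine le_trans ?_ (le_max_left _ _)
    rw [abs_mul, abs_mul, abs_of_nonneg (dist_nonneg (x := z' j))]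
    gcongr
    exact aux_dual_le hf _ _
  have hlim : Filter.Tendsto (fun δ : ℝ => ENNReal.ofReal
      ((∑ j, max |σ j * dist (z' j) (z'' j)| δ ^ p.toReal) ^ (1 / p.toReal)))
      (nhdsWithin 0 (Set.Ioi 0))
      (nhds (ENNReal.ofReal
      ((∑ j, max |σ j * dist (z' j) (z'' j)| 0 ^ p.toReal) ^ (1 / p.toReal)))) := by
    refine Filter.Tendsto.mono_left (Continuous.tendsto ?_ 0) nhdsWithin_le_nhds
    refine ENNReal.continuous_ofReal.comp (Continuous.rpow_const ?_ fun _ => Or.inr (by positivity))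
    refine continuous_finsetSum _ fun j _ => ?_
    exact (continuous_const.max continuous_id).rpow_const fun _ => Or.inr hP.le
  have h5 := ge_of_tendsto hlim (Filter.eventually_of_mem self_mem_nhdsWithin fun δ hδ => hmain δ hδ)
  unfold strongNorm
  rw [aux_elp _ hp.ne' hpt]
  have h6 : ∀ j, max |σ j * dist (z' j) (z'' j)| 0 = |σ j * dist (z' j) (z'' j)| :=
    fun j => max_eq_left (abs_nonneg _)
  simpa only [h6] using h5

theorem aux_main {Y : Type*} [MetricSpace Y] (y₀ : Y) {s p : ℝ≥0∞} (hs : 1 ≤ s)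
    (hp : 0 < p) (hps : p ≤ s) {m : ℕ} (σ : Fin m → ℝ) (z' z'' : Fin m → Y)
    {D : ℝ≥0∞} (hDt : D ≠ ⊤)
    (hD : ∀ w : BanachMap Y, auxGood y₀ s w.T → strongNorm p σ (w.T ∘ z') (w.T ∘ z'') ≤ D) :
    mixedNorm y₀ s p σ z' z'' ≤ D := by
  rcases hps.eq_or_lt with rfl | hlt
  · rw [aux_mixed_self]
    refine iSup₂_le fun f hf => ?_
    rw [← aux_single_eq]
    exact hD ⟨ℝ, f⟩ (aux_good_single hf p)
  · by_cases hst : s = ⊤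
    · subst hst
      exact aux_main_top y₀ hp hlt.ne σ z' z'' hD
    · exact aux_main_lt y₀ hs hp hlt hst σ z' z'' hDt hD

/-- let `1 ≤ s ≤ ∞`, `0 < p ≤ s`, `0 < r ≤ p`. If `S : X → Y` is Lipschitz and
for every Banach space `F` and every Lipschitz `(s,m^L(s;s))`-summing map `T : Y → F` the
composition `T ∘ S` is Lipschitz `(p,m^L(r;r))`-summing, then `S` is Lipschitz
`(m^L(s;p),r)`-summing, and `π^L_{(m^L(s;p),r)}(S)` is the supremum of
`π^L_{(p,m^L(r;r))}(T ∘ S)` over all such `T` with `π^L_{(s,m^L(s;s))}(T) ≤ 1`. -/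
theorem stmt8 {X Y : Type*} [MetricSpace X] [MetricSpace Y] (x₀ : X) (y₀ : Y)
    (s p r : ℝ≥0∞) (hs : 1 ≤ s) (hp : 0 < p) (hps : p ≤ s) (hr : 0 < r) (hrp : r ≤ p)
    (S : X → Y) (K : ℝ≥0) (hS : LipschitzWith K S)
    (h : ∀ w : BanachMap Y, (∃ L : ℝ≥0, LipschitzWith L w.T) →
      LipPMixed y₀ s s s w.T → LipPMixed x₀ p r r (w.T ∘ S)) :
    LipMixedP x₀ y₀ s p r S ∧
    lipMixedPNorm x₀ y₀ s p r S =
      ⨆ (w : BanachMap Y) (_ : (∃ L : ℝ≥0, LipschitzWith L w.T) ∧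
          LipPMixed y₀ s s s w.T ∧ lipPMixedNorm y₀ s s s w.T ≤ 1),
        lipPMixedNorm x₀ p r r (w.T ∘ S) := by
  set C := (⨆ (w : BanachMap Y) (_ : (∃ L : ℝ≥0, LipschitzWith L w.T) ∧
          LipPMixed y₀ s s s w.T ∧ lipPMixedNorm y₀ s s s w.T ≤ 1),
        lipPMixedNorm x₀ p r r (w.T ∘ S)) with hC
  have hCt : C ≠ ⊤ := aux_finite x₀ y₀ s p r hs S h
  have hs0 : s ≠ 0 := (lt_of_lt_of_le one_pos hs).ne'
  have hmain : ∀ (m : ℕ) (σ : Fin m → ℝ) (x' x'' : Fin m → X),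
      mixedNorm y₀ s p σ (S ∘ x') (S ∘ x'') ≤ C * weakNorm x₀ r σ x' x'' := by
    intro m σ x' x''
    refine aux_main y₀ hs hp hps σ _ _ (ENNReal.mul_ne_top hCt (aux_weak_ne_top x₀ r σ x' x'')) ?_
    intro w hw
    have hw1 : ∀ (m : ℕ) (σ : Fin m → ℝ) (x' x'' : Fin m → Y),
        strongNorm s σ (w.T ∘ x') (w.T ∘ x'') ≤ (1 : ℝ≥0) * weakNorm y₀ s σ x' x'' := by
      simpa [auxGood] using hw
    refine aux_norm_spec (T := w.T ∘ S) ?_ hCt σ x' x''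
    refine le_iSup₂_of_le w ⟨⟨1, aux_lip hs0 hw1⟩, ⟨1, fun m σ x' x'' => ?_⟩,
      sInf_le fun m σ x' x'' => ?_⟩ le_rfl
    · rw [aux_mixed_self]; exact hw1 m σ x' x''
    · rw [aux_mixed_self]; exact hw1 m σ x' x''
  refine ⟨⟨C.toNNReal, fun m σ x' x'' => ?_⟩, le_antisymm (sInf_le hmain) ?_⟩
  · rw [ENNReal.coe_toNNReal hCt]
    exact hmain m σ x' x''
  · refine le_sInf fun D hD => iSup₂_le fun w hw => sInf_le fun m σ x' x'' => ?_
    rw [aux_mixed_self]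
    refine le_trans ?_ (hD m σ x' x'')
    refine le_iInf₂ fun τ hτ => ?_
    have h1 := aux_holder hps τ
      (fun j => σ j / τ j * dist ((w.T ∘ S ∘ x') j) ((w.T ∘ S ∘ x'') j))
    have h2 : (fun j => τ j * (σ j / τ j * dist ((w.T ∘ S ∘ x') j) ((w.T ∘ S ∘ x'') j))) =
        fun j => σ j * dist ((w.T ∘ S ∘ x') j) ((w.T ∘ S ∘ x'') j) := by
      funext j
      have := hτ j
      field_simp
    rw [h2] at h1
    refine h1.trans ?_
    gcongr
    have h3 := aux_norm_spec hw.2.2 (by simp) (fun j => σ j / τ j) (S ∘ x') (S ∘ x'')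
    rw [one_mul] at h3
    exact h3
end
end
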